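/- The series G(s) = Σ_{γ>0} γ^{-s}, taken over the positive ordinates γ of the nontrivial zeros of the Riemann zeta function, converges absolutely for Re s > 1 and extends to a function meromorphic on the half-plane Re s > 0 whose only singularity is a double pole at s = 1. Explicitly, there is a constant C₁ such that for Re s > 0, s ≠ 1, one has G(s) = 1/(2π(s-1)²) − (log 2π)/(2π(s-1)) + C₁ + s ∫₁^∞ (S(x)+f(x)) x^{-s-1} dx, where the integral converges absolutely. -/

import Mathlib

open Complex Real MeasureTheory Set Filter

noncomputable section

/-- The multiplicity of `ρ` as a zero of the Riemann zeta function
(the order of vanishing, i.e. the least `n` with `ζ⁽ⁿ⁾(ρ) ≠ 0`). -/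
def zetaMult (ρ : ℂ) : ℕ := sInf {n : ℕ | iteratedDeriv n riemannZeta ρ ≠ 0}

/-- `ρ` is a nontrivial zero of the Riemann zeta function. -/
def IsNontrivialZero (ρ : ℂ) : Prop := riemannZeta ρ = 0 ∧ 0 < ρ.re ∧ ρ.re < 1

/-- `N(T)`, the number of nontrivial zeros with `0 < γ ≤ T`, counted with multiplicity. -/
def Ncount (T : ℝ) : ℝ :=
  ∑' ρ : {ρ : ℂ // IsNontrivialZero ρ ∧ 0 < ρ.im ∧ ρ.im ≤ T}, (zetaMult ρ.1 : ℝ)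

/-- `S` is the function `S(T) = (1/π) arg ζ(1/2 + iT)`, where the argument is obtained by
continuous variation along the straight segments joining `2`, `2 + iT`, `1/2 + iT`, starting
with the value `0` at `2`; if `T` is an ordinate of a zero then `S(T) = S(T+0)`
(right-continuity). -/
def IsS (S : ℝ → ℝ) : Prop :=
  (∀ T : ℝ, 0 < T →
    (∀ σ : ℝ, 1/2 ≤ σ → σ ≤ 2 → riemannZeta (σ + T * I) ≠ 0) →
    ∃ θ : ℝ → ℂ, ContinuousOn θ (Icc 0 2) ∧
      θ 0 = Complex.log (riemannZeta 2) ∧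
      (∀ u ∈ Icc (0:ℝ) 1, Complex.exp (θ u) = riemannZeta (2 + u * T * I)) ∧
      (∀ u ∈ Icc (1:ℝ) 2, Complex.exp (θ u) = riemannZeta (2 - 3/2 * (u - 1) + T * I)) ∧
      S T = (θ 2).im / π) ∧
  (∀ T : ℝ, 0 < T → Tendsto S (nhdsWithin T (Ioi T)) (nhds (S T)))

/-- Two continuous logarithms of the same function on a preconnected set differ by a constant. -/
lemma sub_eq_sub_of_exp_eq {A : Set ℂ} (hA : IsPreconnected A) {F G : ℂ → ℂ}
    (hF : ContinuousOn F A) (hG : ContinuousOn G A)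
    (h : ∀ s ∈ A, Complex.exp (F s) = Complex.exp (G s)) {a b : ℂ} (ha : a ∈ A) (hb : b ∈ A) :
    F a - G a = F b - G b := by
  have hcont : ContinuousOn (fun s => (F s - G s) / (2 * π * I)) A := by fun_prop
  have hInt : ∀ s ∈ A, ∃ n : ℤ, (F s - G s) / (2 * π * I) = n := by
    intro s hs
    obtain ⟨n, hn⟩ := Complex.exp_eq_exp_iff_exists_int.1 (h s hs)
    refine ⟨n, ?_⟩
    rw [hn]
    field_simp [Complex.two_pi_I_ne_zero]
    ring
  have hre : ContinuousOn (fun s => ((F s - G s) / (2 * π * I)).re) A :=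
    Complex.continuous_re.comp_continuousOn hcont
  have hpre := hA.image _ hre
  obtain ⟨m, hm⟩ := hInt a ha
  obtain ⟨n, hn⟩ := hInt b hb
  have key : m = n := by
    by_contra hne
    wlog hlt : m < n generalizing a b m n
    · exact this hb ha n hn m hm (Ne.symm hne) (lt_of_le_of_ne (not_lt.1 hlt) (Ne.symm hne))
    have hsub := hpre.ordConnected.out (mem_image_of_mem _ ha) (mem_image_of_mem _ hb)
    have : (m : ℝ) + 1 / 2 ∈ Icc ((F a - G a) / (2 * π * I)).re ((F b - G b) / (2 * π * I)).re := by
      rw [hm, hn]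
      have : (m : ℝ) + 1 ≤ n := by exact_mod_cast hlt
      constructor <;> (simp only [intCast_re]; linarith)
    obtain ⟨s, hs, hs'⟩ := hsub this
    obtain ⟨k, hk⟩ := hInt s hs
    simp only [hk, intCast_re] at hs'
    have h2 : (2 * k : ℝ) = 2 * m + 1 := by linarith
    have h3 : 2 * k = 2 * m + 1 := by exact_mod_cast h2
    omega
  have : (F a - G a) / (2 * π * I) = (F b - G b) / (2 * π * I) := by rw [hm, hn, key]
  exact (div_left_inj' Complex.two_pi_I_ne_zero).1 this

/-- A holomorphic function without zeros on a disc has a holomorphic logarithm there. -/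
lemma exists_differentiableOn_log {c : ℂ} {r : ℝ} {g : ℂ → ℂ} (hg : Differentiable ℂ g)
    (hr : 0 < r) (h0 : ∀ s ∈ Metric.ball c r, g s ≠ 0) :
    ∃ h : ℂ → ℂ, DifferentiableOn ℂ h (Metric.ball c r) ∧
      ∀ s ∈ Metric.ball c r, Complex.exp (h s) = g s := by
  have hd : DifferentiableOn ℂ (fun s => deriv g s / g s) (Metric.ball c r) :=
    hg.deriv.differentiableOn.div hg.differentiableOn h0
  obtain ⟨h, hh⟩ := (hd.isExactOn_ball).with_val_at c (Complex.log (g c))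
  have hc : c ∈ Metric.ball c r := Metric.mem_ball_self hr
  refine ⟨h, fun s hs => (hh.2 s hs).differentiableAt.differentiableWithinAt, ?_⟩
  have hconst : ∀ s ∈ Metric.ball c r,
      g s * Complex.exp (-h s) = g c * Complex.exp (-h c) := by
    intro s hs
    refine (convex_ball c r).is_const_of_fderivWithin_eq_zero (𝕜 := ℂ)
      (f := fun s => g s * Complex.exp (-h s)) ?_ ?_ hs hc
    · exact fun s hs => (hg.differentiableAt.mul
        (hh.2 s hs).differentiableAt.neg.cexp).differentiableWithinAt
    · intro x hx
      have hgx := h0 x hx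
      have h1 : HasDerivAt (fun s => g s * Complex.exp (-h s)) 0 x :=
        ((hg x).hasDerivAt.fun_mul (hh.2 x hx).fun_neg.cexp).congr_deriv (by field_simp; ring)
      rw [fderivWithin_of_isOpen Metric.isOpen_ball hx]
      ext
      simp [h1.deriv]
  intro s hs
  have h1 := hconst s hs
  rw [hh.1, Complex.exp_neg, Complex.exp_neg, Complex.exp_log (h0 c hc),
    mul_inv_cancel₀ (h0 c hc)] at h1
  field_simp at h1
  exact h1.symm

/-- An entire function that does not vanish identically has finite order everywhere. -/
lemma Differentiable.analyticOrderAt_ne_top {f : ℂ → ℂ} (hf : Differentiable ℂ f) {z₀ : ℂ}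
    (h0 : f z₀ ≠ 0) (z : ℂ) : analyticOrderAt f z ≠ ⊤ := by
  refine AnalyticOnNhd.analyticOrderAt_ne_top_of_isPreconnected (U := univ) (x := z₀)
    (fun x _ => hf.analyticAt x) isPreconnected_univ (mem_univ _) (mem_univ _) ?_
  rw [(hf.analyticAt z₀).analyticOrderAt_eq_zero.2 h0]
  exact ENat.zero_ne_top

/-- Division of an entire function by its zero at a point. -/
lemma exists_differentiable_eq_pow_mul {f : ℂ → ℂ} (hf : Differentiable ℂ f) {z₀ : ℂ}
    (h0 : f z₀ ≠ 0) (a : ℂ) :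
    ∃ g : ℂ → ℂ, Differentiable ℂ g ∧ g a ≠ 0 ∧
      ∀ s, f s = (s - a) ^ analyticOrderNatAt f a * g s := by
  obtain ⟨k, hk, hk0, hkf⟩ := ((hf.analyticAt a).analyticOrderNatAt_eq_iff
    (hf.analyticOrderAt_ne_top h0 a)).1 rfl
  set n := analyticOrderNatAt f a
  have hev : Function.update (fun s => f s / (s - a) ^ n) a (k a) =ᶠ[nhds a] k := by
    filter_upwards [hkf] with s hs
    by_cases hsa : s = a
    · subst hsa; simp
    · rw [Function.update_of_ne hsa, hs, smul_eq_mul,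
        mul_div_cancel_left₀ _ (pow_ne_zero _ (sub_ne_zero.2 hsa))]
  refine ⟨Function.update (fun s => f s / (s - a) ^ n) a (k a), ?_, by simpa using hk0, ?_⟩
  · intro s
    by_cases hsa : s = a
    · subst hsa
      exact hk.differentiableAt.congr_of_eventuallyEq hev
    · have : Function.update (fun s => f s / (s - a) ^ n) a (k a) =ᶠ[nhds s]
          fun s => f s / (s - a) ^ n := by
        filter_upwards [isOpen_ne.mem_nhds hsa] with w hw
        rw [Function.update_of_ne hw]
      refine DifferentiableAt.congr_of_eventuallyEq ?_ this
      exact (hf s).div (by fun_prop) (pow_ne_zero _ (sub_ne_zero.2 hsa))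
  · intro s
    by_cases hsa : s = a
    · subst hsa
      simpa using hkf.self_of_nhds
    · rw [Function.update_of_ne hsa, mul_div_cancel₀ _ (pow_ne_zero _ (sub_ne_zero.2 hsa))]

/-- Division of an entire function by its zeros at finitely many points. -/
lemma exists_differentiable_eq_prod_mul {f : ℂ → ℂ} (hf : Differentiable ℂ f) {z₀ : ℂ}
    (h0 : f z₀ ≠ 0) (Z : Finset ℂ) :
    ∃ g : ℂ → ℂ, Differentiable ℂ g ∧ (∀ a ∈ Z, g a ≠ 0) ∧
      ∀ s, f s = (∏ a ∈ Z, (s - a) ^ analyticOrderNatAt f a) * g s := by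
  classical
  induction Z using Finset.induction_on with
  | empty => exact ⟨f, hf, by simp, by simp⟩
  | insert b Z hb ih =>
    obtain ⟨g, hg, hgZ, hfg⟩ := ih
    have hgz : g z₀ ≠ 0 := fun h => h0 (by rw [hfg, h, mul_zero])
    obtain ⟨k, hk, hkb, hgk⟩ := exists_differentiable_eq_pow_mul hg hgz b
    have hord : analyticOrderNatAt f b = analyticOrderNatAt g b := by
      have hP : Differentiable ℂ (fun s => ∏ a ∈ Z, (s - a) ^ analyticOrderNatAt f a) := by
        fun_prop
      have hPb : (∏ a ∈ Z, (b - a) ^ analyticOrderNatAt f a) ≠ 0 :=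
        Finset.prod_ne_zero_iff.2 fun a ha => pow_ne_zero _ (sub_ne_zero.2 fun h => hb (h ▸ ha))
      have : f = (fun s => ∏ a ∈ Z, (s - a) ^ analyticOrderNatAt f a) * g := funext hfg
      rw [analyticOrderNatAt, this, analyticOrderAt_mul (hP.analyticAt b) (hg.analyticAt b),
        (hP.analyticAt b).analyticOrderAt_eq_zero.2 hPb, zero_add, analyticOrderNatAt]
    refine ⟨k, hk, ?_, ?_⟩
    · intro a ha
      rcases Finset.mem_insert.1 ha with rfl | ha
      · exact hkb
      · exact fun h => hgZ a ha (by rw [hgk, h, mul_zero])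
    · intro s
      rw [Finset.prod_insert hb, hfg s, hgk s, hord]
      ring

/-- Convergence and holomorphy of `∫₁^∞ E(x) x^{-s-1} dx` when `E(x) = O(x^a)` and `Re s > a`. -/
lemma integrableOn_and_differentiableAt_integral_cpow {E : ℝ → ℝ} (hE : Measurable E) {C a : ℝ}
    (hb : ∀ x, 1 < x → |E x| ≤ C * x ^ a) {s : ℂ} (hs : a < s.re) :
    IntegrableOn (fun x : ℝ => (E x : ℂ) * (x : ℂ) ^ (-s - 1)) (Ioi 1) ∧
    DifferentiableAt ℂ (fun s : ℂ => ∫ x in Ioi (1 : ℝ), (E x : ℂ) * (x : ℂ) ^ (-s - 1)) s := by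
  set f : ℝ → ℂ := (Ioi (1 : ℝ)).indicator (fun x => (E x : ℂ)) with hf
  have hfm : Measurable f := (Complex.measurable_ofReal.comp hE).indicator measurableSet_Ioi
  have hfle : ∀ x : ℝ, 0 < x → ‖f x‖ ≤ |C| * x ^ a := by
    intro x hx
    by_cases h1 : 1 < x
    · simp only [hf, indicator_of_mem (mem_Ioi.2 h1), Complex.norm_real, Real.norm_eq_abs]
      refine (hb x h1).trans ?_
      gcongr
      exact le_abs_self C
    · simp only [hf, indicator_of_notMem (show x ∉ Ioi (1 : ℝ) from h1), norm_zero]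
      positivity
  have hloc : LocallyIntegrableOn f (Ioi 0) := by
    have h1 : LocallyIntegrableOn (fun x : ℝ => |C| * x ^ a) (Ioi 0) := by
      refine ContinuousOn.locallyIntegrableOn ?_ measurableSet_Ioi
      intro x hx
      have : x ≠ 0 := ne_of_gt hx
      exact (continuousAt_const.mul (Real.continuousAt_rpow_const x a (Or.inl this)))
        |>.continuousWithinAt
    have h2 : LocallyIntegrableOn ((Ioi (0 : ℝ)).indicator f) (Ioi 0) := by
      refine h1.mono ((hfm.indicator measurableSet_Ioi).aestronglyMeasurable) ?_
      filter_upwards with x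
      by_cases hx : x ∈ Ioi (0 : ℝ)
      · rw [indicator_of_mem hx]
        exact (hfle x hx).trans (le_abs_self _)
      · rw [indicator_of_notMem hx, norm_zero]
        exact norm_nonneg _
    convert h2 using 1
    ext x
    by_cases hx : x ∈ Ioi (0 : ℝ)
    · rw [indicator_of_mem hx]
    · rw [indicator_of_notMem hx, hf, indicator_of_notMem]
      intro h
      exact hx (mem_Ioi.2 (zero_lt_one.trans (mem_Ioi.1 h)))
  have htop : f =O[atTop] (fun x : ℝ => x ^ (-(-a))) := by
    refine Asymptotics.IsBigO.of_bound |C| ?_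
    filter_upwards [eventually_gt_atTop 0] with x hx
    rw [neg_neg, Real.norm_of_nonneg (by positivity)]
    exact hfle x hx
  have hbot : f =O[nhdsWithin 0 (Ioi 0)] (fun x : ℝ => x ^ (-((-s).re - 1))) := by
    refine Asymptotics.IsBigO.of_bound 0 ?_
    filter_upwards [mem_nhdsWithin_of_mem_nhds (Iio_mem_nhds (zero_lt_one))] with x hx
    have hx1 : x ∉ Ioi (1 : ℝ) := fun h => lt_asymm (mem_Iio.1 hx) (mem_Ioi.1 h)
    rw [hf, indicator_of_notMem hx1]
    simp
  have hs1 : (-s).re < -a := by simpa using hs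
  have hcongr : ∀ w : ℂ, ∀ x : ℝ, (x : ℂ) ^ (-w - 1) • f x =
      (Ioi (1 : ℝ)).indicator (fun x : ℝ => (E x : ℂ) * (x : ℂ) ^ (-w - 1)) x := by
    intro w x
    by_cases h1 : x ∈ Ioi (1 : ℝ)
    · rw [hf, indicator_of_mem h1, indicator_of_mem h1, smul_eq_mul, mul_comm]
    · rw [hf, indicator_of_notMem h1, indicator_of_notMem h1, smul_zero]
  constructor
  · have := mellinConvergent_of_isBigO_rpow hloc htop hs1 hbot (by simp)
    rw [MellinConvergent] at this
    simp only [hcongr] at this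
    have h2 := (integrableOn_congr_fun (f := (Ioi (1 : ℝ)).indicator
      (fun x : ℝ => (E x : ℂ) * (x : ℂ) ^ (-s - 1))) (fun x hx => indicator_of_mem hx _)
      measurableSet_Ioi).1 (this.mono_set (Ioi_subset_Ioi zero_le_one))
    exact h2
  · have h1 := mellin_differentiableAt_of_isBigO_rpow hloc htop hs1 hbot (by simp)
    have h2 : (fun s : ℂ => ∫ x in Ioi (1 : ℝ), (E x : ℂ) * (x : ℂ) ^ (-s - 1)) =
        fun s => mellin f (-s) := by
      ext w
      rw [mellin]
      simp only [hcongr]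
      rw [setIntegral_indicator measurableSet_Ioi, inter_eq_self_of_subset_right
        (Ioi_subset_Ioi zero_le_one)]
    rw [h2]
    exact h1.comp s differentiableAt_id.neg

/-- The second periodic antiderivative occurring in the Euler–Maclaurin formula. -/
def fractQuad (x : ℝ) : ℝ := Int.fract x * (1 - Int.fract x) / 2

lemma continuous_fractQuad : Continuous fractQuad := by
  have : Continuous ((fun u : ℝ => u * (1 - u) / 2) ∘ Int.fract) :=
    ContinuousOn.comp_fract'' (by fun_prop) (by simp)
  exact this

lemma fractQuad_nonneg (x : ℝ) : 0 ≤ fractQuad x := by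
  have h1 := Int.fract_nonneg x
  have h2 := (Int.fract_lt_one x).le
  unfold fractQuad
  have := mul_nonneg h1 (sub_nonneg.2 h2)
  linarith

lemma fractQuad_le (x : ℝ) : fractQuad x ≤ 1 / 8 := by
  unfold fractQuad
  nlinarith [sq_nonneg (Int.fract x - 1 / 2)]

lemma hasDerivAt_fractQuad {x : ℝ} (hx : ∀ n : ℤ, (n : ℝ) ≠ x) :
    HasDerivAt fractQuad (1 / 2 - Int.fract x) x := by
  have h1 : (⌊x⌋ : ℝ) < x := lt_of_le_of_ne (Int.floor_le x) (hx _)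
  have h2 : x < ⌊x⌋ + 1 := Int.lt_floor_add_one x
  have hev : fractQuad =ᶠ[nhds x] fun y => (y - ⌊x⌋) * (1 - (y - ⌊x⌋)) / 2 := by
    filter_upwards [Ioo_mem_nhds h1 h2] with y hy
    have : ⌊y⌋ = ⌊x⌋ := Int.floor_eq_iff.2 ⟨hy.1.le, hy.2⟩
    simp only [fractQuad, Int.fract, this]
  refine HasDerivAt.congr_of_eventuallyEq ?_ hev
  have h3 : HasDerivAt (fun y : ℝ => y - ⌊x⌋) 1 x := (hasDerivAt_id x).sub_const _
  refine ((h3.fun_mul (h3.const_sub 1)).div_const 2).congr_deriv ?_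
  simp only [Int.fract]
  ring

lemma hasDerivAt_ofReal_cpow_of_pos {x : ℝ} (hx : 0 < x) (a : ℂ) :
    HasDerivAt (fun y : ℝ => (y : ℂ) ^ a) (a * (x : ℂ) ^ (a - 1)) x := by
  have h := ((hasDerivAt_id (x : ℂ)).cpow_const (c := a) (Or.inl (by simpa using hx))).comp_ofReal
  simpa using h

lemma norm_ofReal_fractQuad_mul_cpow_le {x : ℝ} (hx : 0 < x) (a : ℂ) :
    ‖(fractQuad x : ℂ) * (x : ℂ) ^ a‖ ≤ 1 / 8 * x ^ a.re := by
  rw [norm_mul, Complex.norm_real, Real.norm_of_nonneg (fractQuad_nonneg x),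
    Complex.norm_cpow_eq_rpow_re_of_pos hx]
  gcongr
  exact fractQuad_le x

lemma integrableOn_fractQuad_mul_cpow {s : ℂ} (hs : 0 < s.re) :
    IntegrableOn (fun x : ℝ => (fractQuad x : ℂ) * (x : ℂ) ^ (-s - 1)) (Ioi 1) ∧
    DifferentiableAt ℂ
      (fun s : ℂ => ∫ x in Ioi (1 : ℝ), (fractQuad x : ℂ) * (x : ℂ) ^ (-s - 1)) s := by
  refine integrableOn_and_differentiableAt_integral_cpow (C := 1 / 8) (a := 0)
    continuous_fractQuad.measurable ?_ hs
  intro x _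
  rw [abs_of_nonneg (fractQuad_nonneg x)]
  simpa using fractQuad_le x

lemma integrableOn_half_sub_fract_mul_cpow {s : ℂ} (hs : 0 < s.re) :
    IntegrableOn (fun x : ℝ => ((1 / 2 - Int.fract x : ℝ) : ℂ) * (x : ℂ) ^ (-s - 1)) (Ioi 1) := by
  refine (integrableOn_and_differentiableAt_integral_cpow (C := 1) (a := 0)
    (E := fun x => 1 / 2 - Int.fract x) (measurable_fract.const_sub _) ?_ hs).1
  intro x _
  have h1 := Int.fract_nonneg x
  have h2 := (Int.fract_lt_one x).le
  rw [Real.rpow_zero, mul_one, abs_le]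
  constructor <;> linarith

/-- Integration by parts for the first periodic Bernoulli function. -/
lemma integral_half_sub_fract_mul_cpow {s : ℂ} (hs : 0 < s.re) :
    ∫ x in Ioi (1 : ℝ), ((1 / 2 - Int.fract x : ℝ) : ℂ) * (x : ℂ) ^ (-s - 1) =
      (s + 1) * ∫ x in Ioi (1 : ℝ), (fractQuad x : ℂ) * (x : ℂ) ^ (-(s + 1) - 1) := by
  have hi1 := integrableOn_half_sub_fract_mul_cpow hs
  have hi2 := (integrableOn_fractQuad_mul_cpow (s := s + 1) (by simp; linarith)).1
  have hi : IntegrableOn (fun x : ℝ => ((1 / 2 - Int.fract x : ℝ) : ℂ) * (x : ℂ) ^ (-s - 1) -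
      (s + 1) * ((fractQuad x : ℂ) * (x : ℂ) ^ (-(s + 1) - 1))) (Ioi 1) :=
    hi1.sub (hi2.const_mul _)
  have key : ∫ x in Ioi (1 : ℝ), (((1 / 2 - Int.fract x : ℝ) : ℂ) * (x : ℂ) ^ (-s - 1) -
      (s + 1) * ((fractQuad x : ℂ) * (x : ℂ) ^ (-(s + 1) - 1))) = 0 := by
    refine tendsto_nhds_unique
      (intervalIntegral_tendsto_integral_Ioi 1 hi tendsto_id) ?_
    have hF : ∀ b : ℝ, 1 ≤ b → ∫ x in (1 : ℝ)..b,
        (((1 / 2 - Int.fract x : ℝ) : ℂ) * (x : ℂ) ^ (-s - 1) -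
        (s + 1) * ((fractQuad x : ℂ) * (x : ℂ) ^ (-(s + 1) - 1))) =
        (fractQuad b : ℂ) * (b : ℂ) ^ (-s - 1) := by
      intro b hb
      have := integral_eq_of_hasDerivAt_off_countable_of_le
        (fun x : ℝ => (fractQuad x : ℂ) * (x : ℂ) ^ (-s - 1))
        (fun x : ℝ => ((1 / 2 - Int.fract x : ℝ) : ℂ) * (x : ℂ) ^ (-s - 1) -
        (s + 1) * ((fractQuad x : ℂ) * (x : ℂ) ^ (-(s + 1) - 1))) hb
        (s := range ((↑) : ℤ → ℝ)) (countable_range _) ?_ ?_ ?_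
      · rw [this]
        simp [fractQuad]
      · intro x hx
        have hx0 : x ≠ 0 := by linarith [hx.1]
        refine ContinuousAt.continuousWithinAt ?_
        exact (Complex.continuous_ofReal.comp continuous_fractQuad).continuousAt.mul
          (Complex.continuousAt_ofReal_cpow_const _ _ (Or.inr hx0))
      · intro x hx
        have hx0 : 0 < x := by linarith [hx.1.1]
        have h1 := (hasDerivAt_fractQuad (x := x) (fun n hn => hx.2 ⟨n, hn⟩)).ofReal_comp
        refine (h1.fun_mul (hasDerivAt_ofReal_cpow_of_pos hx0 (-s - 1))).congr_deriv ?_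
        rw [show -(s + 1) - 1 = -s - 1 - 1 by ring]
        ring
      · rw [intervalIntegrable_iff, uIoc_of_le hb]
        exact hi.mono_set Ioc_subset_Ioi_self
    have hlim : Tendsto (fun b : ℝ => (fractQuad b : ℂ) * (b : ℂ) ^ (-s - 1)) atTop (nhds 0) := by
      rw [tendsto_zero_iff_norm_tendsto_zero]
      have h0 : Tendsto (fun b : ℝ => 1 / 8 * b ^ (-(s.re + 1))) atTop (nhds 0) := by
        simpa using (tendsto_rpow_neg_atTop (show 0 < s.re + 1 by linarith)).const_mul (1 / 8 : ℝ)
      refine squeeze_zero' (Eventually.of_forall fun _ => norm_nonneg _) ?_ h0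
      filter_upwards [eventually_gt_atTop 0] with b hb
      refine (norm_ofReal_fractQuad_mul_cpow_le hb _).trans (le_of_eq ?_)
      congr 2
      simp
      ring
    refine hlim.congr' ?_
    filter_upwards [eventually_ge_atTop 1] with b hb
    rw [id, hF b hb]
  rw [integral_sub hi1 (hi2.const_mul _), integral_const_mul, sub_eq_zero] at key
  exact key

/-- Euler–Maclaurin representation in the half plane of absolute convergence. -/
lemma riemannZeta_eq_euler_maclaurin {s : ℂ} (hs : 1 < s.re) :
    riemannZeta s = s / (s - 1) - 1 / 2 + s * (s + 1) *
      ∫ x in Ioi (1 : ℝ), (fractQuad x : ℂ) * (x : ℂ) ^ (-(s + 1) - 1) := by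
  have hs0 : s ≠ 0 := by rintro rfl; simp at hs; linarith
  have hs1 : s - 1 ≠ 0 := by
    intro h
    rw [sub_eq_zero.1 h] at hs
    simp at hs
  have h1 : riemannZeta s = s * ∫ x in Ioi (1 : ℝ), (⌊x⌋₊ : ℂ) * (x : ℂ) ^ (-(s + 1)) := by
    rw [← LSeries_one_eq_riemannZeta hs, LSeries_eq_mul_integral' 1 zero_le_one hs]
    · simp
    · refine Asymptotics.IsBigO.of_bound 1 ?_
      filter_upwards with n
      simp
  have hA : IntegrableOn (fun x : ℝ => (x : ℂ) ^ (-s)) (Ioi 1) :=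
    integrableOn_Ioi_cpow_of_lt (by simpa using hs) zero_lt_one
  have hB : IntegrableOn (fun x : ℝ => (x : ℂ) ^ (-s - 1)) (Ioi 1) :=
    integrableOn_Ioi_cpow_of_lt (by simp; linarith) zero_lt_one
  have hC := integrableOn_half_sub_fract_mul_cpow (s := s) (by linarith)
  have h2 : ∫ x in Ioi (1 : ℝ), (⌊x⌋₊ : ℂ) * (x : ℂ) ^ (-(s + 1)) =
      ∫ x in Ioi (1 : ℝ), ((x : ℂ) ^ (-s) - 1 / 2 * (x : ℂ) ^ (-s - 1) +
        ((1 / 2 - Int.fract x : ℝ) : ℂ) * (x : ℂ) ^ (-s - 1)) := by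
    refine setIntegral_congr_fun measurableSet_Ioi fun x hx => ?_
    have hx0 : (0 : ℝ) < x := zero_lt_one.trans hx
    have hxc : (x : ℂ) ≠ 0 := by exact_mod_cast hx0.ne'
    have h3 : (x : ℂ) ^ (-s) = x * (x : ℂ) ^ (-s - 1) := by
      rw [Complex.cpow_sub _ _ hxc, Complex.cpow_one]
      field_simp
    have h4 : ((⌊x⌋₊ : ℕ) : ℂ) = ((x - Int.fract x : ℝ) : ℂ) := by
      rw [Int.self_sub_fract, ← natCast_floor_eq_intCast_floor hx0.le]
      simp
    rw [h3, h4, show -(s + 1) = -s - 1 by ring]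
    push_cast
    ring
  have hAB : IntegrableOn (fun x : ℝ => (x : ℂ) ^ (-s) - 1 / 2 * (x : ℂ) ^ (-s - 1)) (Ioi 1) :=
    hA.sub (hB.const_mul _)
  rw [h1, h2, integral_add hAB hC, integral_sub hA (hB.const_mul _),
    integral_const_mul, integral_half_sub_fract_mul_cpow (by linarith),
    integral_Ioi_cpow_of_lt (by simpa using hs) zero_lt_one,
    integral_Ioi_cpow_of_lt (by simp; linarith) zero_lt_one]
  have hs2 : -s + 1 ≠ 0 := fun h => hs1 (by linear_combination -h)
  simp only [ofReal_one, Complex.one_cpow, sub_add_cancel]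
  field_simp
  ring

/-- The entire function `(s - 1) ζ(s)` in the half plane `Re s > -1`. -/
lemma riemannZeta₁_eq_euler_maclaurin {s : ℂ} (hs : -1 < s.re) :
    riemannZeta₁ s = (s + 1) / 2 * (1 + 2 * s * (s - 1) *
      ∫ x in Ioi (1 : ℝ), (fractQuad x : ℂ) * (x : ℂ) ^ (-(s + 1) - 1)) := by
  have hopen : IsOpen {s : ℂ | -1 < s.re} := isOpen_lt continuous_const Complex.continuous_re
  have hpre : IsPreconnected {s : ℂ | -1 < s.re} := (convex_halfSpace_re_gt (-1)).isPreconnected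
  have hR : DifferentiableOn ℂ (fun s : ℂ => (s + 1) / 2 * (1 + 2 * s * (s - 1) *
      ∫ x in Ioi (1 : ℝ), (fractQuad x : ℂ) * (x : ℂ) ^ (-(s + 1) - 1))) {s : ℂ | -1 < s.re} := by
    intro w hw
    have h1 := (integrableOn_fractQuad_mul_cpow (s := w + 1)
      (by have : -1 < w.re := hw; simp; linarith)).2
    have h2 : DifferentiableAt ℂ (fun s : ℂ => ∫ x in Ioi (1 : ℝ),
        (fractQuad x : ℂ) * (x : ℂ) ^ (-(s + 1) - 1)) w :=
      DifferentiableAt.comp (f := fun s : ℂ => s + 1) w h1 (differentiableAt_id.add_const 1)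
    refine DifferentiableAt.differentiableWithinAt ?_
    fun_prop
  refine AnalyticOnNhd.eqOn_of_preconnected_of_eventuallyEq (z₀ := 2)
    (fun x _ => differentiable_riemannZeta₁.analyticAt x) (hR.analyticOnNhd hopen) hpre
    (by simp; norm_num) ?_ hs
  have : {s : ℂ | 1 < s.re} ∈ nhds (2 : ℂ) :=
    (isOpen_lt continuous_const Complex.continuous_re).mem_nhds (by simp)
  filter_upwards [this] with w hw
  have hw1 : w ≠ 1 := by rintro rfl; simp at hw
  have hw2 : w - 1 ≠ 0 := sub_ne_zero.2 hw1
  have h := riemannZeta_eq_inv_sub_mul hw1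
  rw [riemannZeta_eq_euler_maclaurin hw] at h
  field_simp at h ⊢
  linear_combination -h

lemma norm_integral_fractQuad_le {s : ℂ} (hs : 0 < s.re) :
    ‖∫ x in Ioi (1 : ℝ), (fractQuad x : ℂ) * (x : ℂ) ^ (-(s + 1) - 1)‖ ≤ 1 / 8 := by
  have h1 : IntegrableOn (fun x : ℝ => 1 / 8 * x ^ (-(s.re + 2))) (Ioi 1) :=
    (integrableOn_Ioi_rpow_of_lt (by linarith) zero_lt_one).const_mul _
  refine (norm_integral_le_of_norm_le h1 ?_).trans ?_
  · refine (ae_restrict_iff' measurableSet_Ioi).2 (Eventually.of_forall fun x hx => ?_)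
    have hx0 : (0 : ℝ) < x := zero_lt_one.trans hx
    refine (norm_ofReal_fractQuad_mul_cpow_le hx0 _).trans (le_of_eq ?_)
    congr 2
    simp
    ring
  · rw [integral_const_mul, integral_Ioi_rpow_of_lt (by linarith) zero_lt_one, Real.one_rpow]
    have : (-1 : ℝ) / (-(s.re + 2) + 1) ≤ 1 := by
      rw [div_le_one_of_neg (by linarith)]
      linarith
    linarith

/-- `(s - 1) ζ(s)` has polynomial growth in the right half plane. -/
lemma norm_riemannZeta₁_le {s : ℂ} (hs : 0 < s.re) :
    ‖riemannZeta₁ s‖ ≤ (‖s‖ + 1) ^ 3 := by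
  rw [riemannZeta₁_eq_euler_maclaurin (by linarith)]
  set K := ∫ x in Ioi (1 : ℝ), (fractQuad x : ℂ) * (x : ℂ) ^ (-(s + 1) - 1)
  have hK : ‖K‖ ≤ 1 / 8 := norm_integral_fractQuad_le hs
  have h1 : ‖s + 1‖ ≤ ‖s‖ + 1 := by simpa using norm_add_le s 1
  have h2 : ‖s - 1‖ ≤ ‖s‖ + 1 := by simpa using norm_sub_le s 1
  have h3 : ‖1 + 2 * s * (s - 1) * K‖ ≤ 1 + 2 * ‖s‖ * (‖s‖ + 1) * (1 / 8) := by
    refine (norm_add_le _ _).trans ?_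
    rw [norm_one, norm_mul, norm_mul, norm_mul, Complex.norm_ofNat]
    gcongr
  have h4 := norm_nonneg s
  calc ‖(s + 1) / 2 * (1 + 2 * s * (s - 1) * K)‖
      = ‖s + 1‖ / 2 * ‖1 + 2 * s * (s - 1) * K‖ := by simp
    _ ≤ (‖s‖ + 1) / 2 * (1 + 2 * ‖s‖ * (‖s‖ + 1) * (1 / 8)) := by gcongr
    _ ≤ (‖s‖ + 1) ^ 3 := by
      have h5 : (1 + 2 * ‖s‖ * (‖s‖ + 1) * (1 / 8)) / 2 ≤ (‖s‖ + 1) ^ 2 := by nlinarith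
      nlinarith

/-- `ζ` has no zero in the critical strip of height at most one. -/
lemma riemannZeta₁_ne_zero_of_abs_im_le {s : ℂ} (h0 : 0 < s.re) (h1 : s.re < 1)
    (him : |s.im| ≤ 1) : riemannZeta₁ s ≠ 0 := by
  rw [riemannZeta₁_eq_euler_maclaurin (by linarith)]
  set K := ∫ x in Ioi (1 : ℝ), (fractQuad x : ℂ) * (x : ℂ) ^ (-(s + 1) - 1)
  have hK : ‖K‖ ≤ 1 / 8 := norm_integral_fractQuad_le h0
  have him2 : s.im ^ 2 ≤ 1 := (sq_le_one_iff_abs_le_one _).2 him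
  have hs : ‖s‖ ≤ 3 / 2 := by
    refine abs_le_of_sq_le_sq' ?_ (by norm_num) |>.2
    rw [Complex.sq_norm, Complex.normSq_apply]
    nlinarith
  have hs1 : ‖s - 1‖ ≤ 3 / 2 := by
    refine abs_le_of_sq_le_sq' ?_ (by norm_num) |>.2
    rw [Complex.sq_norm, Complex.normSq_apply]
    simp
    nlinarith
  refine mul_ne_zero (div_ne_zero ?_ two_ne_zero) ?_
  · intro h
    have := congrArg Complex.re h
    simp at this
    linarith
  · intro h
    have h2 : 2 * s * (s - 1) * K = -1 := by linear_combination h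
    have h3 := congrArg norm h2
    rw [norm_mul, norm_mul, norm_mul, Complex.norm_ofNat, norm_neg, norm_one] at h3
    have h4 : 2 * ‖s‖ * ‖s - 1‖ * ‖K‖ ≤ 2 * (3 / 2) * (3 / 2) * (1 / 8) := by gcongr
    linarith

lemma norm_log_one_add_sub_le {w : ℂ} (hw : 0 ≤ w.re) :
    ‖Complex.log (1 + w) - w‖ ≤ ‖w‖ ^ 2 := by
  have hre : ∀ t ∈ Icc (0 : ℝ) 1, 1 ≤ (1 + (t : ℂ) * w).re := by
    intro t ht
    have := mul_nonneg ht.1 hw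
    simp only [add_re, one_re, re_ofReal_mul]
    linarith
  have hd : ∀ t ∈ Icc (0 : ℝ) 1, HasDerivWithinAt
      (fun t : ℝ => Complex.log (1 + (t : ℂ) * w) - (t : ℂ) * w)
      (w / (1 + (t : ℂ) * w) - w) (Icc 0 1) t := by
    intro t ht
    have h1 : HasDerivAt (fun t : ℝ => (t : ℂ) * w) w t := by
      simpa using (Complex.ofRealCLM.hasDerivAt (x := t)).mul_const w
    have h2 : 1 + (t : ℂ) * w ∈ slitPlane := Or.inl (by linarith [hre t ht])
    exact (((h1.const_add 1).clog_real h2).sub h1).hasDerivWithinAt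
  have hb : ∀ t ∈ Ico (0 : ℝ) 1, ‖w / (1 + (t : ℂ) * w) - w‖ ≤ ‖w‖ ^ 2 := by
    intro t ht
    have h1 : 1 ≤ ‖1 + (t : ℂ) * w‖ := (hre t ⟨ht.1, ht.2.le⟩).trans (re_le_norm _)
    have h0 : 1 + (t : ℂ) * w ≠ 0 := by
      rw [← norm_pos_iff]; linarith
    have h2 : w / (1 + (t : ℂ) * w) - w = -((t : ℂ) * w ^ 2) / (1 + (t : ℂ) * w) := by
      rw [eq_div_iff h0, sub_mul, div_mul_cancel₀ _ h0]; ring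
    rw [h2, norm_div, norm_neg, norm_mul, norm_pow, Complex.norm_real, Real.norm_of_nonneg ht.1]
    rw [div_le_iff₀ (by linarith)]
    nlinarith [sq_nonneg ‖w‖, ht.2, mul_le_mul_of_nonneg_right ht.2.le (sq_nonneg ‖w‖)]
  simpa using norm_image_sub_le_of_norm_deriv_le_segment_01' hd hb

/-- The `k`-th term of Euler's series for the logarithm of `z * Γ(z)`. -/
def logGammaTerm (k : ℕ) (z : ℂ) : ℂ :=
  z * Real.log (k + 2) - z * Real.log (k + 1)
    - (Complex.log (z + (k + 1 : ℕ)) - Real.log (k + 1))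

/-- A continuous logarithm of `Γ` on the right half-plane. -/
def logGammaSeries (z : ℂ) : ℂ := -Complex.log z + ∑' k, logGammaTerm k z

lemma log_add_natCast_eq {z : ℂ} (hz : 0 < z.re) {n : ℕ} (hn : n ≠ 0) :
    Complex.log (z + n) = Real.log n + Complex.log (1 + z / n) := by
  have hn' : (0 : ℝ) < n := by positivity
  have hre : 0 < (1 + z / n).re := by
    have : 0 < (z / n).re := by
      rw [div_natCast_re]; positivity
    simp only [add_re, one_re]; linarith
  have h0 : 1 + z / n ≠ 0 := by
    intro h; rw [h] at hre; simp at hre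
  rw [← Complex.log_ofReal_mul hn' h0]
  congr 1
  have : (n : ℂ) ≠ 0 := by exact_mod_cast hn
  push_cast
  field_simp
  ring

lemma norm_logGammaTerm_le {z : ℂ} (hz : 0 < z.re) (k : ℕ) :
    ‖logGammaTerm k z‖ ≤ (‖z‖ + ‖z‖ ^ 2) * (1 / ((k : ℝ) + 1) ^ 2) := by
  have hk : (0 : ℝ) < (k : ℝ) + 1 := by positivity
  have e1 : Real.log (k + 2) = Real.log (k + 1) + Real.log (1 + 1 / (k + 1)) := by
    rw [← Real.log_mul (by positivity) (by positivity)]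
    congr 1; field_simp; ring
  have e2 := log_add_natCast_eq hz (Nat.succ_ne_zero k)
  have e3 : logGammaTerm k z =
      z * (Complex.log (1 + ((1 / (k + 1) : ℝ) : ℂ)) - ((1 / (k + 1) : ℝ) : ℂ)) -
      (Complex.log (1 + z / (k + 1 : ℕ)) - z / (k + 1 : ℕ)) := by
    have e4 : Complex.log (1 + ((1 / (k + 1) : ℝ) : ℂ)) = (Real.log (1 + 1 / (k + 1)) : ℝ) := by
      rw [Complex.ofReal_log (by positivity)]; norm_cast
    rw [logGammaTerm, e1, e4, e2]
    push_cast
    have : (k : ℂ) + 1 ≠ 0 := by exact_mod_cast hk.ne'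
    field_simp
    ring
  have b1 := norm_log_one_add_sub_le (w := ((1 / (k + 1) : ℝ) : ℂ))
    (by rw [ofReal_re]; positivity)
  have b2 := norm_log_one_add_sub_le (w := z / (k + 1 : ℕ))
    (by rw [div_natCast_re]; positivity)
  have n1 : ‖((1 / (k + 1) : ℝ) : ℂ)‖ ^ 2 = 1 / ((k : ℝ) + 1) ^ 2 := by
    rw [Complex.norm_real, Real.norm_of_nonneg (by positivity)]; simp
  have n2 : ‖z / ((k + 1 : ℕ) : ℂ)‖ ^ 2 = ‖z‖ ^ 2 * (1 / ((k : ℝ) + 1) ^ 2) := by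
    rw [norm_div, Complex.norm_natCast]; push_cast; field_simp
  rw [n1] at b1
  rw [n2] at b2
  rw [e3]
  refine (norm_sub_le _ _).trans ?_
  rw [norm_mul, add_mul]
  gcongr

lemma summable_one_div_nat_succ_sq : Summable fun k : ℕ => 1 / ((k : ℝ) + 1) ^ 2 := by
  have := (summable_nat_add_iff 1).2 (Real.summable_one_div_nat_pow.2 one_lt_two)
  simpa using this

lemma continuousOn_logGammaSeries : ContinuousOn logGammaSeries {z | 0 < z.re} := by
  have hopen : IsOpen {z : ℂ | 0 < z.re} := isOpen_lt continuous_const continuous_re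
  intro z₀ hz₀
  set A : Set ℂ := {z | 0 < z.re} ∩ Metric.ball 0 (‖z₀‖ + 1) with hA
  have hAn : A ∈ nhds z₀ :=
    (hopen.inter Metric.isOpen_ball).mem_nhds ⟨hz₀, by simp⟩
  suffices h : ContinuousOn logGammaSeries A from (h.continuousAt hAn).continuousWithinAt
  have hslit : ∀ z ∈ A, z ∈ slitPlane := fun z hz => Or.inl hz.1
  refine (continuousOn_id.clog hslit).neg.add
    (continuousOn_tsum (u := fun k : ℕ => ((‖z₀‖ + 1) + (‖z₀‖ + 1) ^ 2) *
      (1 / ((k : ℝ) + 1) ^ 2)) (fun k => ?_) (summable_one_div_nat_succ_sq.mul_left _) ?_)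
  · unfold logGammaTerm
    have : ∀ z ∈ A, z + ((k + 1 : ℕ) : ℂ) ∈ slitPlane := by
      intro z hz
      refine Or.inl ?_
      rw [add_re, natCast_re]
      have : 0 < z.re := hz.1
      positivity
    have h2 := ContinuousOn.clog (continuousOn_id.add continuousOn_const) this
    exact ContinuousOn.sub (by fun_prop) (h2.sub continuousOn_const)
  · intro k z hz
    refine (norm_logGammaTerm_le hz.1 k).trans ?_
    have : ‖z‖ ≤ ‖z₀‖ + 1 := by simpa using (mem_ball_zero_iff.1 hz.2).le
    gcongr

lemma neg_log_add_sum_logGammaTerm (z : ℂ) (n : ℕ) :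
    -Complex.log z + ∑ k ∈ Finset.range n, logGammaTerm k z =
      z * Real.log (n + 1) + Real.log n.factorial
        - ∑ k ∈ Finset.range (n + 1), Complex.log (z + k) := by
  induction n with
  | zero => simp
  | succ n ih =>
    rw [Finset.sum_range_succ, ← add_assoc, ih, Finset.sum_range_succ _ (n + 1), logGammaTerm,
      Nat.factorial_succ]
    have : Real.log (((n + 1) * n.factorial : ℕ) : ℝ) =
        Real.log (n + 1) + Real.log n.factorial := by
      push_cast
      rw [Real.log_mul (by positivity) (by positivity)]
    rw [this]
    push_cast
    ring_nf

lemma tendsto_logGammaSeries {z : ℂ} (hz : 0 < z.re) :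
    Tendsto (fun n : ℕ => z * Real.log (n + 1) + Real.log n.factorial
        - ∑ k ∈ Finset.range (n + 1), Complex.log (z + k)) atTop (nhds (logGammaSeries z)) := by
  simp_rw [← neg_log_add_sum_logGammaTerm]
  have : Summable fun k => logGammaTerm k z :=
    Summable.of_norm_bounded (summable_one_div_nat_succ_sq.mul_left _)
      (fun k => norm_logGammaTerm_le hz k)
  exact this.hasSum.tendsto_sum_nat.const_add _

lemma exp_logGammaSeries {z : ℂ} (hz : 0 < z.re) :
    Complex.exp (logGammaSeries z) = Complex.Gamma z := by
  have h1 := (Complex.continuous_exp.tendsto _).comp (tendsto_logGammaSeries hz)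
  have h2 : Tendsto (fun n : ℕ => Complex.GammaSeq z (n + 1) * ((z + (n + 1 : ℕ)) / (n + 1 : ℕ)))
      atTop (nhds (Complex.Gamma z * 1)) := by
    refine ((Complex.GammaSeq_tendsto_Gamma z).comp (tendsto_add_atTop_nat 1)).mul ?_
    have h3 : Tendsto (fun n : ℕ => z / (n : ℂ) + 1) atTop (nhds (0 + 1)) :=
      (tendsto_const_div_atTop_nhds_zero_nat z).add_const 1
    rw [zero_add] at h3
    refine (h3.comp (tendsto_add_atTop_nat 1)).congr fun n => ?_
    have : ((n + 1 : ℕ) : ℂ) ≠ 0 := by exact_mod_cast Nat.succ_ne_zero n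
    simp only [Function.comp_apply]
    field_simp
  rw [mul_one] at h2
  refine tendsto_nhds_unique h1 (h2.congr fun n => ?_)
  have hne : ∀ k : ℕ, z + k ≠ 0 := by
    intro k h
    have := congrArg Complex.re h
    rw [add_re, natCast_re, zero_re] at this
    have : (0 : ℝ) ≤ k := by positivity
    linarith
  have hn : ((n + 1 : ℕ) : ℂ) ≠ 0 := by exact_mod_cast Nat.succ_ne_zero n
  have e1 : Complex.exp (z * Real.log (n + 1)) = ((n + 1 : ℕ) : ℂ) ^ z := by
    rw [Complex.cpow_def_of_ne_zero hn, mul_comm]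
    congr 2
    rw [Complex.ofReal_log (by positivity)]
    push_cast
    rfl
  have e2 : Complex.exp (Real.log n.factorial : ℝ) = (n.factorial : ℂ) := by
    rw [← Complex.ofReal_exp, Real.exp_log (by positivity)]
    norm_cast
  have e3 : Complex.exp (∑ k ∈ Finset.range (n + 1), Complex.log (z + k)) =
      ∏ k ∈ Finset.range (n + 1), (z + k) := by
    rw [Complex.exp_sum]
    exact Finset.prod_congr rfl fun k _ => Complex.exp_log (hne k)
  simp only [Function.comp_apply]
  rw [Complex.exp_sub, Complex.exp_add, e1, e2, e3, Complex.GammaSeq,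
    Finset.prod_range_succ _ (n + 1), Nat.factorial_succ]
  have hp : ∏ k ∈ Finset.range (n + 1), (z + k) ≠ 0 :=
    Finset.prod_ne_zero_iff.2 fun k _ => hne k
  have := hne (n + 1)
  push_cast at *
  field_simp

/-- An antiderivative in `v` of `arg (v + iy)`. -/
def argPrimitive (y v : ℝ) : ℝ := ((v + y * I) * Complex.log (v + y * I) - (v + y * I)).im

lemma hasDerivAt_argPrimitive (y : ℝ) {v : ℝ} (hv : 0 < v) :
    HasDerivAt (argPrimitive y) (arg (v + y * I)) v := by
  have h1 : HasDerivAt (fun v : ℝ => (v : ℂ) + y * I) 1 v := by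
    simpa using (Complex.ofRealCLM.hasDerivAt (x := v)).add_const (y * I)
  have hs : (v : ℂ) + y * I ∈ slitPlane := Or.inl (by simpa using hv)
  have h0 : (v : ℂ) + y * I ≠ 0 := slitPlane_ne_zero hs
  have h2 := ((h1.fun_mul (h1.clog_real hs)).fun_sub h1)
  have h3 := (Complex.imCLM.hasFDerivAt.comp_hasDerivAt v h2)
  refine h3.congr_deriv ?_
  simp only [imCLM_apply]
  rw [mul_one_div_cancel h0, one_mul, add_sub_cancel_right, log_im]

lemma arg_le_arg_of_le {y v w : ℝ} (hy : 0 ≤ y) (hv : 0 < v) (hvw : v ≤ w) :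
    arg (w + y * I) ≤ arg (v + y * I) := by
  rw [arg_of_re_nonneg (by simpa using hv.le.trans hvw), arg_of_re_nonneg (by simpa using hv.le)]
  apply Real.monotone_arcsin
  have h : ∀ u : ℝ, ‖(u : ℂ) + y * I‖ = √(u ^ 2 + y ^ 2) := fun u => Complex.norm_add_mul_I u y
  rw [h, h]
  simp only [add_im, ofReal_im, mul_im, ofReal_re, I_im, mul_one, I_re, mul_zero, add_zero,
    zero_add]
  have : 0 < √(v ^ 2 + y ^ 2) := Real.sqrt_pos.2 (by positivity)
  gcongr

lemma argPrimitive_step {y v : ℝ} (hy : 0 ≤ y) (hv : 0 < v) :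
    arg (((v + 1 : ℝ) : ℂ) + y * I) ≤ argPrimitive y (v + 1) - argPrimitive y v ∧
      argPrimitive y (v + 1) - argPrimitive y v ≤ arg (v + y * I) := by
  have hd : ∀ u ∈ Icc v (v + 1), HasDerivAt (argPrimitive y) (arg (u + y * I)) u :=
    fun u hu => hasDerivAt_argPrimitive y (hv.trans_le hu.1)
  obtain ⟨c, hc, h⟩ := exists_hasDerivAt_eq_slope (argPrimitive y) (fun u => arg (u + y * I))
    (by linarith : v < v + 1) (fun u hu => (hd u hu).continuousAt.continuousWithinAt)
    (fun u hu => hd u (Ioo_subset_Icc_self hu))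
  rw [add_sub_cancel_left, div_one] at h
  rw [← h]
  exact ⟨arg_le_arg_of_le hy (hv.trans hc.1) hc.2.le, arg_le_arg_of_le hy hv hc.1.le⟩

lemma sum_arg_bounds {y x : ℝ} (hy : 0 ≤ y) (hx : 0 < x) (n : ℕ) :
    argPrimitive y (x + n) - argPrimitive y x ≤
        ∑ k ∈ Finset.range n, arg (((x + k : ℝ) : ℂ) + y * I) ∧
      ∑ k ∈ Finset.range n, arg (((x + k : ℝ) : ℂ) + y * I) + arg (((x + n : ℝ) : ℂ) + y * I) ≤
        argPrimitive y (x + n) - argPrimitive y x + arg (x + y * I) := by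
  induction n with
  | zero => simp
  | succ n ih =>
    have h := argPrimitive_step (v := x + n) hy (by positivity)
    rw [Finset.sum_range_succ]
    have e : x + ((n + 1 : ℕ) : ℝ) = x + n + 1 := by push_cast; ring
    rw [e]
    constructor <;> linarith [h.1, h.2, ih.1, ih.2]

lemma tendsto_argPrimitive_sub {x y : ℝ} (hx : 0 < x) :
    Tendsto (fun n : ℕ => argPrimitive y (x + (n + 1 : ℕ)) - y * Real.log (n + 1)) atTop
      (nhds 0) := by
  set z : ℂ := x + y * I with hz
  have hzre : 0 < z.re := by simpa [hz] using hx
  have hlim : Tendsto (fun n : ℕ => ((n : ℂ) + z) * Complex.log (1 + z / n)) atTop (nhds z) := by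
    have h1 : Tendsto (fun n : ℕ => z + z ^ 2 / (n : ℂ)) atTop (nhds (z + 0)) :=
      (tendsto_const_div_atTop_nhds_zero_nat _).const_add _
    have h2 : Tendsto (fun n : ℕ => ((n : ℂ) + z) * (Complex.log (1 + z / n) - z / n)) atTop
        (nhds 0) := by
      have h3 : Tendsto (fun n : ℕ => ‖z‖ ^ 2 * (1 / (n : ℝ) + ‖z‖ * (1 / (n : ℝ) * (1 / (n : ℝ)))))
          atTop (nhds (‖z‖ ^ 2 * (0 + ‖z‖ * (0 * 0)))) := by
        have := tendsto_const_div_atTop_nhds_zero_nat (1 : ℝ)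
        exact (this.add ((this.mul this).const_mul _)).const_mul _
      simp only [mul_zero, add_zero] at h3
      refine squeeze_zero_norm' ?_ h3
      filter_upwards [eventually_gt_atTop 0] with n hn
      have hn' : (0 : ℝ) < n := by exact_mod_cast hn
      have h4 := norm_log_one_add_sub_le (w := z / n) (by rw [div_natCast_re]; positivity)
      rw [norm_div, Complex.norm_natCast] at h4
      have h5 : ‖(n : ℂ) + z‖ ≤ n + ‖z‖ := (norm_add_le _ _).trans (by simp)
      rw [norm_mul]
      calc _ ≤ (n + ‖z‖) * (‖z‖ / n) ^ 2 := by gcongr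
        _ = _ := by field_simp
    have := h1.add h2
    simp only [add_zero] at this
    refine this.congr' ?_
    filter_upwards [eventually_gt_atTop 0] with n hn
    have hn' : (n : ℂ) ≠ 0 := by exact_mod_cast hn.ne'
    field_simp
    ring
  have h1 := (Complex.continuous_im.tendsto _).comp (hlim.comp (tendsto_add_atTop_nat 1))
  have h2 := h1.sub_const y
  have hzim : z.im = y := by simp [hz]
  rw [hzim, sub_self] at h2
  refine h2.congr fun n => ?_
  have e : ((x + (n + 1 : ℕ) : ℝ) : ℂ) + y * I = z + (n + 1 : ℕ) := by rw [hz]; push_cast; ring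
  have l := log_add_natCast_eq (n := n + 1) hzre (Nat.succ_ne_zero n)
  simp only [Function.comp_apply]
  rw [argPrimitive, e, l, mul_add, sub_im, add_im, im_mul_ofReal]
  simp only [add_im, natCast_im, add_zero, hzim, Nat.cast_add, Nat.cast_one, one_im]
  rw [add_comm ((n : ℂ) + 1) z]
  ring

lemma abs_im_logGammaSeries_sub_le {x y : ℝ} (hx : 0 < x) (hy : 0 ≤ y) :
    |(logGammaSeries (x + y * I)).im - argPrimitive y x| ≤ π / 2 := by
  have hre : 0 < ((x : ℂ) + y * I).re := by simpa using hx
  have h1 := (Complex.continuous_im.tendsto _).comp (tendsto_logGammaSeries hre)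
  have h2 := (h1.sub_const (argPrimitive y x)).add (tendsto_argPrimitive_sub (y := y) hx)
  rw [add_zero] at h2
  have ha : arg ((x : ℂ) + y * I) ≤ π / 2 :=
    (abs_arg_le_pi_div_two_iff.2 hre.le |> abs_le.1).2
  refine le_of_tendsto h2.abs (Eventually.of_forall fun n => ?_)
  have hb := sum_arg_bounds hy hx (n + 1)
  have h0 : 0 ≤ arg (((x + (n + 1 : ℕ) : ℝ) : ℂ) + y * I) := by
    rw [arg_nonneg_iff]; simpa using hy
  simp only [Function.comp_apply]
  have e : ((x + y * I) * (Real.log (n + 1) : ℝ) + (Real.log n.factorial : ℝ)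
      - ∑ k ∈ Finset.range (n + 1), Complex.log ((x + y * I) + k)).im =
      y * Real.log (n + 1) - ∑ k ∈ Finset.range (n + 1), arg (((x + k : ℝ) : ℂ) + y * I) := by
    rw [sub_im, add_im, im_mul_ofReal, Complex.im_sum]
    congr 1
    · rw [ofReal_im]; simp
    · refine Finset.sum_congr rfl fun k _ => ?_
      rw [log_im]; congr 1; push_cast; ring
  rw [e, abs_le]
  constructor <;> linarith [hb.1, hb.2]

lemma abs_im_logGammaSeries_quarter_sub_le {y : ℝ} (hy : 1 / 2 ≤ y) :
    |(logGammaSeries (1 / 4 + y * I)).im - (y * Real.log y - y)| ≤ 4 := by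
  have h1 := abs_im_logGammaSeries_sub_le (x := 1 / 4) (by norm_num) (by linarith : 0 ≤ y)
  have hre : 0 < (((1 / 4 : ℝ) : ℂ) + y * I).re := by simp
  have ha := abs_arg_le_pi_div_two_iff.2 hre.le
  have e : argPrimitive y (1 / 4) = 1 / 4 * arg (((1 / 4 : ℝ) : ℂ) + y * I) +
      y * Real.log ‖((1 / 4 : ℝ) : ℂ) + y * I‖ - y := by
    rw [argPrimitive, sub_im, mul_im, log_im, log_re]
    simp
  have hn : ‖((1 / 4 : ℝ) : ℂ) + y * I‖ = √((1 / 4) ^ 2 + y ^ 2) := Complex.norm_add_mul_I _ y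
  have hlow : y ≤ ‖((1 / 4 : ℝ) : ℂ) + y * I‖ := by
    rw [hn]; exact Real.le_sqrt_of_sq_le (by nlinarith)
  have hup : ‖((1 / 4 : ℝ) : ℂ) + y * I‖ ≤ y + 1 / 4 := by
    rw [hn]; exact Real.sqrt_le_iff.2 ⟨by linarith, by nlinarith⟩
  have hl1 : Real.log y ≤ Real.log ‖((1 / 4 : ℝ) : ℂ) + y * I‖ :=
    Real.log_le_log (by linarith) hlow
  have hl2 : Real.log ‖((1 / 4 : ℝ) : ℂ) + y * I‖ - Real.log y ≤ 1 / 4 / y := by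
    rw [← Real.log_div (by linarith) (by linarith)]
    refine (Real.log_le_sub_one_of_pos (div_pos (by linarith) (by linarith))).trans ?_
    rw [div_sub_one (by linarith)]
    gcongr
    linarith
  have hl3 : y * (Real.log ‖((1 / 4 : ℝ) : ℂ) + y * I‖ - Real.log y) ≤ 1 / 4 := by
    calc _ ≤ y * (1 / 4 / y) := by gcongr
      _ = 1 / 4 := by field_simp
  have hl4 : 0 ≤ y * (Real.log ‖((1 / 4 : ℝ) : ℂ) + y * I‖ - Real.log y) :=
    mul_nonneg (by linarith) (by linarith)
  have hpi := Real.pi_lt_d2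
  have e2 : (((1 / 4 : ℝ) : ℂ)) = 1 / 4 := by push_cast; rfl
  rw [e] at h1
  rw [← e2]
  rw [abs_le] at *
  constructor <;> linarith [h1.1, h1.2, ha.1, ha.2]

lemma Differentiable.finite_zeros_inter_closedBall {f : ℂ → ℂ} (hf : Differentiable ℂ f) {z₀ : ℂ}
    (h0 : f z₀ ≠ 0) (c : ℂ) (R : ℝ) : {s | f s = 0 ∧ s ∈ Metric.closedBall c R}.Finite := by
  by_contra hinf
  obtain ⟨x, -, hx⟩ := Set.Infinite.exists_accPt_of_subset_isCompact hinf
    (isCompact_closedBall c R) (fun s hs => hs.2)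
  rw [accPt_iff_frequently_nhdsNE] at hx
  have := AnalyticOnNhd.eqOn_zero_of_preconnected_of_frequently_eq_zero (U := univ) (z₀ := x)
    (fun z _ => hf.analyticAt z) isPreconnected_univ (mem_univ _) (hx.mono fun z hz => hz.1)
  exact h0 (this (mem_univ z₀))

/-- The numerator of the Blaschke factor of the disc with centre `c` and radius `R`. -/
def blaschkeNum (R : ℝ) (c a s : ℂ) : ℂ := (R ^ 2 - (starRingEnd ℂ) (a - c) * (s - c)) / R

lemma norm_blaschkeNum_of_mem_sphere {R : ℝ} (hR : 0 < R) {c a s : ℂ} (hs : ‖s - c‖ = R) :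
    ‖blaschkeNum R c a s‖ = ‖s - a‖ := by
  have h1 : (R : ℂ) ^ 2 = (starRingEnd ℂ) (s - c) * (s - c) := by
    rw [mul_comm, Complex.mul_conj, Complex.normSq_eq_norm_sq, hs]; push_cast; rfl
  rw [blaschkeNum, h1, ← sub_mul, ← map_sub, norm_div, norm_mul, RCLike.norm_conj, hs,
    Complex.norm_real, Real.norm_of_nonneg hR.le, mul_div_cancel_right₀ _ hR.ne']
  congr 1; ring

lemma blaschkeNum_re_pos {R : ℝ} (hR : 0 < R) {c a s : ℂ} (ha : ‖a - c‖ < R) (hs : ‖s - c‖ < R) :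
    0 < (blaschkeNum R c a s).re := by
  rw [blaschkeNum, div_ofReal_re]
  refine div_pos ?_ hR
  have h1 : ((starRingEnd ℂ) (a - c) * (s - c)).re ≤ ‖a - c‖ * ‖s - c‖ := by
    refine (re_le_norm _).trans ?_
    rw [norm_mul, RCLike.norm_conj]
  have h2 : ((R : ℂ) ^ 2).re = R ^ 2 := by rw [← ofReal_pow, ofReal_re]
  rw [sub_re, h2]
  nlinarith [norm_nonneg (a - c), norm_nonneg (s - c)]

lemma blaschkeNum_ne_zero {R : ℝ} (hR : 0 < R) {c a s : ℂ} (ha : ‖a - c‖ < R)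
    (hs : ‖s - c‖ < R) : blaschkeNum R c a s ≠ 0 := by
  intro h
  have := blaschkeNum_re_pos hR ha hs
  rw [h] at this
  simp at this

lemma exists_log_mul_blaschke {f : ℂ → ℂ} (hf : Differentiable ℂ f) {c : ℂ} {M μ : ℝ}
    (hμ : 0 < μ) (hM : ∀ s, ‖s - c‖ = 15 / 8 → ‖f s‖ ≤ M) (hc : μ ≤ ‖f c‖) :
    ∃ (Z : Finset ℂ) (m : ℂ → ℕ) (h : ℂ → ℂ), DifferentiableOn ℂ h (Metric.ball c (7 / 4)) ∧
      (∀ a ∈ Z, f a = 0 ∧ ‖a - c‖ ≤ 7 / 4) ∧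
      (∀ s ∈ Metric.ball c (7 / 4), f s * ∏ a ∈ Z, blaschkeNum (15 / 8) c a s ^ m a =
        (∏ a ∈ Z, (s - a) ^ m a) * Complex.exp (h s)) ∧
      μ * (15 / 14) ^ (∑ a ∈ Z, m a) ≤ M ∧
      (∀ s ∈ Metric.ball c (7 / 4), ‖Complex.exp (h s)‖ ≤ M) ∧ μ ≤ ‖Complex.exp (h c)‖ := by
  have hfc : f c ≠ 0 := by
    rw [← norm_pos_iff]; linarith
  set Z := (hf.finite_zeros_inter_closedBall hfc c (7 / 4)).toFinset with hZ
  have hmem : ∀ a, a ∈ Z ↔ f a = 0 ∧ ‖a - c‖ ≤ 7 / 4 := by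
    intro a; simp [hZ, dist_eq_norm]
  obtain ⟨g, hg, hgZ, hfg⟩ := exists_differentiable_eq_prod_mul hf hfc Z
  set m := analyticOrderNatAt f with hm
  set G : ℂ → ℂ := fun s => g s * ∏ a ∈ Z, blaschkeNum (15 / 8) c a s ^ m a with hG
  have hGd : Differentiable ℂ G := by
    simp only [hG, blaschkeNum]; fun_prop
  have hG0 : ∀ s ∈ Metric.ball c (7 / 4), G s ≠ 0 := by
    intro s hs
    rw [mem_ball_iff_norm] at hs
    refine mul_ne_zero (fun h => ?_) (Finset.prod_ne_zero_iff.2 fun a ha => pow_ne_zero _ ?_)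
    · exact hgZ s ((hmem s).2 ⟨by rw [hfg, h, mul_zero], hs.le⟩) h
    · exact blaschkeNum_ne_zero (by norm_num) (((hmem a).1 ha).2.trans_lt (by norm_num))
        (hs.trans (by norm_num))
  have hGM : ∀ s ∈ Metric.closedBall c (15 / 8), ‖G s‖ ≤ M := by
    intro s hs
    refine Complex.norm_le_of_forall_mem_frontier_norm_le (U := Metric.ball c (15 / 8))
      Metric.isBounded_ball hGd.diffContOnCl (fun z hz => ?_)
      (by rwa [closure_ball _ (by norm_num)])
    rw [frontier_ball _ (by norm_num), mem_sphere_iff_norm] at hz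
    have : ‖G z‖ = ‖f z‖ := by
      rw [hfg, hG, norm_mul, norm_mul, norm_prod, norm_prod, mul_comm]
      congr 1
      refine Finset.prod_congr rfl fun a _ => ?_
      rw [norm_pow, norm_pow, norm_blaschkeNum_of_mem_sphere (by norm_num) hz]
    rw [this]
    exact hM z hz
  have hGc : μ * (15 / 14) ^ (∑ a ∈ Z, m a) ≤ ‖G c‖ := by
    have h1 : ‖f c‖ ≤ (7 / 4) ^ (∑ a ∈ Z, m a) * ‖g c‖ := by
      rw [hfg, norm_mul, norm_prod, ← Finset.prod_pow_eq_pow_sum]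
      gcongr with a ha
      rw [norm_pow, norm_sub_rev]
      exact pow_le_pow_left₀ (norm_nonneg _) ((hmem a).1 ha).2 _
    have h2 : ‖G c‖ = ‖g c‖ * (15 / 8) ^ (∑ a ∈ Z, m a) := by
      rw [hG, norm_mul, norm_prod, ← Finset.prod_pow_eq_pow_sum]
      congr 1
      refine Finset.prod_congr rfl fun a _ => ?_
      rw [norm_pow, blaschkeNum]
      congr 1
      rw [sub_self, mul_zero, sub_zero]
      norm_num
    have h3 : (15 / 8 : ℝ) ^ (∑ a ∈ Z, m a) =
        (15 / 14) ^ (∑ a ∈ Z, m a) * (7 / 4) ^ (∑ a ∈ Z, m a) := by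
      rw [← mul_pow]; norm_num
    rw [h2, h3]
    calc _ ≤ ((7 / 4) ^ (∑ a ∈ Z, m a) * ‖g c‖) * (15 / 14) ^ (∑ a ∈ Z, m a) := by
          gcongr; exact hc.trans h1
      _ = _ := by ring
  obtain ⟨h, hhd, hh⟩ := exists_differentiableOn_log hGd (by norm_num : (0 : ℝ) < 7 / 4) hG0
  have hcc : c ∈ Metric.closedBall c (15 / 8) := Metric.mem_closedBall_self (by norm_num)
  refine ⟨Z, m, h, hhd, fun a ha => (hmem a).1 ha, fun s hs => ?_, hGc.trans (hGM c hcc),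
    fun s hs => ?_, ?_⟩
  · rw [hh s hs, hfg s, hG]; ring
  · rw [hh s hs]
    exact hGM s (Metric.ball_subset_closedBall (Metric.ball_subset_ball (by norm_num) hs))
  · rw [hh c (Metric.mem_ball_self (by norm_num))]
    refine le_trans ?_ hGc
    exact le_mul_of_one_le_right hμ.le (one_le_pow₀ (by norm_num))

/-- Backlund's bound: the variation of the argument of an entire function along a horizontal
segment is controlled by its growth. -/
lemma abs_im_log_sub_le {f : ℂ → ℂ} (hf : Differentiable ℂ f) {c : ℂ} {M μ : ℝ}
    (hμ : 0 < μ) (hM : ∀ s, ‖s - c‖ = 15 / 8 → ‖f s‖ ≤ M) (hc : μ ≤ ‖f c‖)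
    (hline : ∀ s : ℂ, ‖s - c‖ ≤ 7 / 4 → s.im = c.im → f s ≠ 0) {W : ℂ → ℂ} {A : Set ℂ}
    (hA : IsPreconnected A) (hAim : ∀ s ∈ A, s.im = c.im) (hAc : ∀ s ∈ A, ‖s - c‖ ≤ 3 / 2)
    (hW : ContinuousOn W A) (hWf : ∀ s ∈ A, Complex.exp (W s) = f s) (hcA : c ∈ A) {b : ℂ}
    (hb : b ∈ A) :
    |(W b).im - (W c).im| ≤ 300 * (Real.log (M / μ) + 1) := by
  obtain ⟨Z, m, h, hhd, hZ, hfac, hn, hhM, hhμ⟩ := exists_log_mul_blaschke hf hμ hM hc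
  have hAball : ∀ s ∈ A, s ∈ Metric.ball c (7 / 4) := fun s hs => by
    rw [mem_ball_iff_norm]; linarith [hAc s hs]
  have hcb : c ∈ Metric.ball c (7 / 4) := Metric.mem_ball_self (by norm_num)
  have hMpos : 0 < M := hμ.trans_le (hhμ.trans (hhM c hcb))
  have hlog0 : 0 ≤ Real.log (M / μ) :=
    Real.log_nonneg ((one_le_div hμ).2 (hhμ.trans (hhM c hcb)))
  set K := Real.log (M / μ) + 1 with hK
  have hnK : (∑ a ∈ Z, m a : ℕ) * (1 / 15 : ℝ) ≤ K := by
    have h1 : (15 / 14 : ℝ) ^ (∑ a ∈ Z, m a) ≤ M / μ := by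
      rw [le_div_iff₀ hμ, mul_comm]; exact hn
    have h2 := Real.log_le_log (by positivity) h1
    rw [Real.log_pow] at h2
    have h3 : (1 / 15 : ℝ) ≤ Real.log (15 / 14) := by
      have := Real.one_sub_inv_le_log_of_pos (by norm_num : (0 : ℝ) < 15 / 14)
      norm_num at this ⊢
      linarith
    have h4 : ((∑ a ∈ Z, m a : ℕ) : ℝ) * (1 / 15 : ℝ) ≤
        ((∑ a ∈ Z, m a : ℕ) : ℝ) * Real.log (15 / 14) := by gcongr
    linarith
  have hhb : ‖h b - h c‖ ≤ 12 * K := by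
    have hd : DifferentiableOn ℂ (fun w => h (w + c) - h c) (Metric.ball 0 (7 / 4)) := by
      refine DifferentiableOn.sub_const (hhd.comp (by fun_prop) fun w hw => ?_) _
      simpa using hw
    have hmaps : MapsTo (fun w => h (w + c) - h c) (Metric.ball 0 (7 / 4)) {z | z.re ≤ K} := by
      intro w hw
      have hw' : w + c ∈ Metric.ball c (7 / 4) := by simpa using hw
      have h1 := hhM _ hw'
      rw [Complex.norm_exp] at h1 hhμ
      have h2 := (Real.le_log_iff_exp_le hMpos).2 h1
      have h3 := (Real.log_le_iff_le_exp hμ).2 hhμ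
      show (h (w + c) - h c).re ≤ K
      rw [sub_re, hK, Real.log_div hMpos.ne' hμ.ne']
      linarith
    have hbc := hAc b hb
    have := Complex.borelCaratheodory_zero (by linarith : 0 < K) hd hmaps (by norm_num)
      (z := b - c) (by rw [mem_ball_zero_iff]; linarith) (by simp)
    rw [sub_add_cancel] at this
    refine this.trans ?_
    rw [div_le_iff₀ (by linarith)]
    nlinarith [norm_nonneg (b - c)]
  set V : ℂ → ℂ := fun s => h s + ∑ a ∈ Z, (m a : ℂ) *
    (Complex.log (s - a) - Complex.log (blaschkeNum (15 / 8) c a s)) with hV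
  have hsa : ∀ s ∈ A, ∀ a ∈ Z, s - a ∈ slitPlane := by
    intro s hs a ha
    refine Or.inr ?_
    rw [sub_im, hAim s hs, sub_ne_zero]
    intro h
    exact hline a (hZ a ha).2 h.symm (hZ a ha).1
  have hbre : ∀ s ∈ A, ∀ a ∈ Z, 0 < (blaschkeNum (15 / 8) c a s).re := fun s hs a ha =>
    blaschkeNum_re_pos (by norm_num) ((hZ a ha).2.trans_lt (by norm_num))
      ((hAc s hs).trans_lt (by norm_num))
  have hVc : ContinuousOn V A := by
    refine (hhd.continuousOn.mono hAball).add (continuousOn_finsetSum _ fun a ha => ?_)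
    refine continuousOn_const.mul (ContinuousOn.sub ?_ ?_)
    · exact ContinuousOn.clog (by fun_prop) fun s hs => hsa s hs a ha
    · refine ContinuousOn.clog ?_ fun s hs => Or.inl (hbre s hs a ha)
      unfold blaschkeNum; fun_prop
  have hVf : ∀ s ∈ A, Complex.exp (W s) = Complex.exp (V s) := by
    intro s hs
    have hb0 : ∀ a ∈ Z, blaschkeNum (15 / 8) c a s ≠ 0 := fun a ha =>
      slitPlane_ne_zero (Or.inl (hbre s hs a ha))
    have e1 : ∏ a ∈ Z, Complex.exp ((m a : ℂ) *
        (Complex.log (s - a) - Complex.log (blaschkeNum (15 / 8) c a s))) =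
        (∏ a ∈ Z, (s - a) ^ m a) / ∏ a ∈ Z, blaschkeNum (15 / 8) c a s ^ m a := by
      rw [← Finset.prod_div_distrib]
      refine Finset.prod_congr rfl fun a ha => ?_
      rw [Complex.exp_nat_mul, Complex.exp_sub, Complex.exp_log (slitPlane_ne_zero (hsa s hs a ha)),
        Complex.exp_log (hb0 a ha), div_pow]
    have hp : ∏ a ∈ Z, blaschkeNum (15 / 8) c a s ^ m a ≠ 0 :=
      Finset.prod_ne_zero_iff.2 fun a ha => pow_ne_zero _ (hb0 a ha)
    rw [hWf s hs, hV, Complex.exp_add, Complex.exp_sum, e1, mul_div_assoc', eq_div_iff hp,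
      hfac s (hAball s hs), mul_comm]
  have hWV := sub_eq_sub_of_exp_eq hA hW hVc hVf hb hcA
  have hdiff : (W b).im - (W c).im = (h b - h c).im + ∑ a ∈ Z, (m a : ℝ) *
      ((arg (b - a) - arg (blaschkeNum (15 / 8) c a b)) -
        (arg (c - a) - arg (blaschkeNum (15 / 8) c a c))) := by
    have : (W b).im - (W c).im = (V b).im - (V c).im := by
      have := congrArg Complex.im hWV
      simp only [sub_im] at this
      linarith
    rw [this, hV]
    have e : ∀ (n : ℕ) (z : ℂ), ((n : ℂ) * z).im = n * z.im := fun n z => by simp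
    simp only [add_im, sub_im, im_sum, e, log_im, mul_sub, Finset.sum_sub_distrib]
    ring
  have hsum : |∑ a ∈ Z, (m a : ℝ) * ((arg (b - a) - arg (blaschkeNum (15 / 8) c a b)) -
        (arg (c - a) - arg (blaschkeNum (15 / 8) c a c)))| ≤ (∑ a ∈ Z, m a : ℕ) * 16 := by
    push_cast
    rw [Finset.sum_mul]
    refine (Finset.abs_sum_le_sum_abs _ _).trans (Finset.sum_le_sum fun a _ => ?_)
    rw [abs_mul, Nat.abs_cast]
    gcongr
    have hpi := Real.pi_lt_four
    have h1 := abs_le.1 (abs_arg_le_pi (b - a))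
    have h2 := abs_le.1 (abs_arg_le_pi (c - a))
    have h3 := abs_le.1 (abs_arg_le_pi (blaschkeNum (15 / 8) c a b))
    have h4 := abs_le.1 (abs_arg_le_pi (blaschkeNum (15 / 8) c a c))
    rw [abs_le]
    constructor <;> linarith [h1.1, h1.2, h2.1, h2.2, h3.1, h3.2, h4.1, h4.2]
  rw [hdiff]
  refine (abs_add_le _ _).trans ?_
  have := (abs_im_le_norm (h b - h c)).trans hhb
  linarith

lemma norm_riemannZeta_sub_one_le {s : ℂ} (hs : 2 ≤ s.re) :
    ‖riemannZeta s - 1‖ ≤ π ^ 2 / 6 - 1 := by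
  have hs1 : 1 < s.re := by linarith
  have h2 : HasSum (fun n : ℕ => 1 / ((n : ℝ) + 1) ^ 2) (π ^ 2 / 6) := by
    have := (hasSum_nat_add_iff' 1).2 hasSum_zeta_two
    simpa using this
  have hn : ∀ n : ℕ, ‖1 / ((n : ℂ) + 1) ^ s‖ ≤ 1 / ((n : ℝ) + 1) ^ 2 := by
    intro n
    have e : ((n : ℂ) + 1) = ((n + 1 : ℝ) : ℂ) := by push_cast; rfl
    rw [e, norm_div, norm_one, Complex.norm_cpow_eq_rpow_re_of_pos (by positivity),
      ← Real.rpow_natCast]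
    have h1 : (1 : ℝ) ≤ (n : ℝ) + 1 := by linarith [(Nat.cast_nonneg n : (0 : ℝ) ≤ n)]
    gcongr
    push_cast
    exact hs
  have hsum : Summable fun n : ℕ => 1 / ((n : ℂ) + 1) ^ s :=
    Summable.of_norm_bounded h2.summable hn
  rw [zeta_eq_tsum_one_div_nat_add_one_cpow hs1, hsum.tsum_eq_zero_add]
  simp only [Nat.cast_zero, zero_add, one_cpow, div_one, add_sub_cancel_left]
  have h3 := (hasSum_nat_add_iff' 1).2 h2
  simp only [Finset.range_one, Finset.sum_singleton, Nat.cast_zero, zero_add, one_pow,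
    div_one] at h3
  exact tsum_of_norm_bounded h3 fun n => hn (n + 1)

lemma pi_sq_div_six_sub_one_lt : π ^ 2 / 6 - 1 < 7 / 10 := by
  have := Real.pi_lt_d2
  have := Real.pi_pos
  nlinarith

lemma abs_im_log_riemannZeta₁_sub_le {T : ℝ} (hT : 2 ≤ T)
    (hline : ∀ s : ℂ, 0 < s.re → s.im = T → riemannZeta₁ s ≠ 0) {W : ℂ → ℂ} {A : Set ℂ}
    (hA : IsPreconnected A) (hAim : ∀ s ∈ A, s.im = T) (hAc : ∀ s ∈ A, s.re ∈ Icc (1 / 2 : ℝ) 2)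
    (hW : ContinuousOn W A) (hWf : ∀ s ∈ A, Complex.exp (W s) = riemannZeta₁ s)
    (hcA : 2 + T * I ∈ A) (hb : 1 / 2 + T * I ∈ A) :
    |(W (1 / 2 + T * I)).im - (W (2 + T * I)).im| ≤ 300 * (Real.log (10 * (T + 5) ^ 3) + 1) := by
  have hcre : (2 + T * I : ℂ).re = 2 := by simp
  have hcim : (2 + T * I : ℂ).im = T := by simp
  have hre : ∀ s : ℂ, ‖s - (2 + T * I)‖ ≤ 15 / 8 → 0 < s.re := by
    intro s hs
    have := (abs_le.1 ((abs_re_le_norm _).trans hs)).1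
    rw [sub_re, hcre] at this
    linarith
  have hcn : ‖(2 + T * I : ℂ)‖ ≤ 2 + T := by
    refine (norm_add_le _ _).trans ?_
    simp [abs_of_nonneg (by linarith : 0 ≤ T)]
  have key := abs_im_log_sub_le differentiable_riemannZeta₁ (c := 2 + T * I) (M := (T + 5) ^ 3)
    (μ := 1 / 10) (by norm_num) (fun s hs => ?_) ?_ (fun s hs hsi => ?_) hA
    (by simpa [hcim] using hAim) (fun s hs => ?_) hW hWf hcA hb
  · rwa [div_div_eq_mul_div, div_one, mul_comm _ (10 : ℝ)] at key
  · refine (norm_riemannZeta₁_le (hre s hs.le)).trans ?_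
    have : ‖s‖ ≤ ‖s - (2 + T * I)‖ + ‖(2 + T * I : ℂ)‖ := norm_le_norm_sub_add _ _
    exact pow_le_pow_left₀ (by positivity) (by linarith) _
  · have h1 : (2 + T * I : ℂ) ≠ 1 := by
      intro h; have := congrArg Complex.re h; simp at this
    have h2 : riemannZeta₁ (2 + T * I) = (2 + T * I - 1) * riemannZeta (2 + T * I) := by
      rw [riemannZeta_eq_inv_sub_mul h1, mul_inv_cancel_left₀ (sub_ne_zero.2 h1)]
    have h3 := norm_riemannZeta_sub_one_le (s := 2 + T * I) (by simp)
    have h4 : 3 / 10 ≤ ‖riemannZeta (2 + T * I)‖ := by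
      have := norm_sub_norm_le (1 : ℂ) (1 - riemannZeta (2 + T * I))
      rw [sub_sub_cancel, norm_one, norm_sub_rev] at this
      linarith [pi_sq_div_six_sub_one_lt]
    have h5 : 1 ≤ ‖(2 + T * I - 1 : ℂ)‖ := by
      refine le_trans ?_ (re_le_norm _)
      simp; norm_num
    rw [h2, norm_mul]
    nlinarith
  · exact hline s (hre s (hs.trans (by norm_num))) (by rw [hsi, hcim])
  · have e : s - (2 + T * I) = ((s.re - 2 : ℝ) : ℂ) := by
      apply Complex.ext <;> simp [hAim s hs]
    have := hAc s hs
    rw [e, Complex.norm_real, Real.norm_eq_abs, abs_le]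
    constructor <;> linarith [this.1, this.2]

/-- Riemann's `ξ` function, up to a factor of two. -/
def riemannXi (s : ℂ) : ℂ := s * (s - 1) * completedRiemannZeta₀ s + 1

lemma differentiable_riemannXi : Differentiable ℂ riemannXi := by
  have := differentiable_completedZeta₀
  unfold riemannXi
  fun_prop

lemma riemannXi_one_sub (s : ℂ) : riemannXi (1 - s) = riemannXi s := by
  rw [riemannXi, riemannXi, completedRiemannZeta₀_one_sub]; ring

lemma riemannXi_one : riemannXi 1 = 1 := by simp [riemannXi]

lemma riemannZeta₁_eq_mul {s : ℂ} (hs : s ≠ 1) : riemannZeta₁ s = (s - 1) * riemannZeta s := by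
  rw [riemannZeta_eq_inv_sub_mul hs, mul_inv_cancel_left₀ (sub_ne_zero.2 hs)]

lemma riemannXi_eq_mul {s : ℂ} (hs : 0 < s.re) :
    riemannXi s = s * Gammaℝ s * riemannZeta₁ s := by
  have hs0 : s ≠ 0 := by rintro rfl; simp at hs
  by_cases hs1 : s = 1
  · subst hs1; simp [riemannXi, riemannZeta₁_one, Gammaℝ_one]
  · have hs1' : s - 1 ≠ 0 := sub_ne_zero.2 hs1
    have hs1'' : 1 - s ≠ 0 := sub_ne_zero.2 (Ne.symm hs1)
    have hG := Gammaℝ_ne_zero_of_re_pos hs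
    rw [riemannZeta₁_eq_mul hs1, riemannZeta_def_of_ne_zero hs0, completedRiemannZeta_eq, riemannXi]
    have e : 1 / (1 - s) = -(1 / (s - 1)) := by
      rw [← neg_sub s 1, div_neg]
    rw [e]
    field_simp
    ring

lemma Complex.conj_two : (starRingEnd ℂ) (2 : ℂ) = 2 := map_ofNat _ 2

lemma Gammaℝ_conj (s : ℂ) : Gammaℝ ((starRingEnd ℂ) s) = (starRingEnd ℂ) (Gammaℝ s) := by
  have e : (starRingEnd ℂ) s / 2 = (starRingEnd ℂ) (s / 2) := by simp [Complex.conj_two]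
  have hpi : (π : ℂ) ≠ 0 := by exact_mod_cast Real.pi_ne_zero
  rw [Gammaℝ_def, Gammaℝ_def, map_mul, e, Complex.Gamma_conj, Complex.cpow_def_of_ne_zero hpi,
    Complex.cpow_def_of_ne_zero hpi, ← Complex.exp_conj, map_mul,
    ← Complex.ofReal_log Real.pi_pos.le,
    Complex.conj_ofReal]
  simp [Complex.conj_two]

lemma riemannXi_conj (s : ℂ) :
    riemannXi ((starRingEnd ℂ) s) = (starRingEnd ℂ) (riemannXi s) := by
  have key : ∀ s : ℂ, 0 < s.re →
      riemannXi ((starRingEnd ℂ) s) = (starRingEnd ℂ) (riemannXi s) := by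
    intro s hs
    rw [riemannXi_eq_mul hs, riemannXi_eq_mul (by simpa using hs), Gammaℝ_conj, map_mul, map_mul]
    congr 1
    by_cases hs1 : s = 1
    · subst hs1; simp [riemannZeta₁_one]
    · have : (starRingEnd ℂ) s ≠ 1 := by
        intro h; apply hs1; simpa using congrArg (starRingEnd ℂ) h
      rw [riemannZeta₁_eq_mul hs1, riemannZeta₁_eq_mul this, riemannZeta_conj]
      simp
  by_cases hs : 0 < s.re
  · exact key s hs
  · have := key (1 - s) (by rw [sub_re, one_re]; linarith)
    rwa [map_sub, map_one, riemannXi_one_sub, riemannXi_one_sub] at this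

lemma riemannXi_ne_zero_of_one_le_re {s : ℂ} (hs : 1 ≤ s.re) : riemannXi s ≠ 0 := by
  by_cases hs1 : s = 1
  · subst hs1; rw [riemannXi_one]; exact one_ne_zero
  · rw [riemannXi_eq_mul (by linarith), riemannZeta₁_eq_mul hs1]
    refine mul_ne_zero (mul_ne_zero ?_ (Gammaℝ_ne_zero_of_re_pos (by linarith)))
      (mul_ne_zero (sub_ne_zero.2 hs1) (riemannZeta_ne_zero_of_one_le_re hs))
    rintro rfl; simp at hs; linarith

lemma riemannXi_eq_zero_iff (s : ℂ) : riemannXi s = 0 ↔ IsNontrivialZero s := by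
  constructor
  · intro h
    have h1 : s.re < 1 := by
      by_contra! h1; exact riemannXi_ne_zero_of_one_le_re h1 h
    have h0 : 0 < s.re := by
      by_contra! h0
      refine riemannXi_ne_zero_of_one_le_re (s := 1 - s) ?_ (by rw [riemannXi_one_sub, h])
      rw [sub_re, one_re]; linarith
    refine ⟨?_, h0, h1⟩
    have hs1 : s ≠ 1 := by rintro rfl; simp at h1
    have hs0 : s ≠ 0 := by rintro rfl; simp at h0
    rw [riemannXi_eq_mul h0, riemannZeta₁_eq_mul hs1] at h
    simpa [hs0, sub_ne_zero.2 hs1, Gammaℝ_ne_zero_of_re_pos h0] using h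
  · rintro ⟨h, h0, h1⟩
    have hs1 : s ≠ 1 := by rintro rfl; simp at h1
    rw [riemannXi_eq_mul h0, riemannZeta₁_eq_mul hs1, h, mul_zero, mul_zero]

lemma IsNontrivialZero.abs_im {ρ : ℂ} (h : IsNontrivialZero ρ) : 1 < |ρ.im| := by
  by_contra! hle
  have hs1 : ρ ≠ 1 := by
    rintro rfl; have := h.2.2; simp at this
  refine riemannZeta₁_ne_zero_of_abs_im_le h.2.1 h.2.2 hle ?_
  rw [riemannZeta₁_eq_mul hs1, h.1, mul_zero]

lemma analyticOrderNatAt_eq_of_eq_pow_mul {f g : ℂ → ℂ} {a : ℂ} {n : ℕ} (hg : Differentiable ℂ g)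
    (hga : g a ≠ 0) (hfg : ∀ s, f s = (s - a) ^ n * g s) : analyticOrderNatAt f a = n := by
  have hf : Differentiable ℂ f := by
    rw [funext hfg]; fun_prop
  have : analyticOrderAt f a = n := by
    rw [(hf.analyticAt a).analyticOrderAt_eq_natCast]
    exact ⟨g, hg.analyticAt a, hga, Eventually.of_forall fun s => hfg s⟩
  rw [analyticOrderNatAt, this, ENat.toNat_natCast]

lemma riemannXi_one_ne_zero : riemannXi 1 ≠ 0 := by rw [riemannXi_one]; exact one_ne_zero

lemma analyticOrderNatAt_riemannXi_one_sub (ρ : ℂ) :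
    analyticOrderNatAt riemannXi (1 - ρ) = analyticOrderNatAt riemannXi ρ := by
  obtain ⟨g, hg, hgρ, hfg⟩ :=
    exists_differentiable_eq_pow_mul differentiable_riemannXi riemannXi_one_ne_zero ρ
  refine analyticOrderNatAt_eq_of_eq_pow_mul
    (g := fun s => (-1) ^ analyticOrderNatAt riemannXi ρ * g (1 - s)) (by fun_prop) ?_ ?_
  · simpa using hgρ
  · intro s
    rw [← riemannXi_one_sub, hfg, ← mul_assoc, ← mul_pow]
    congr 2; ring

lemma analyticOrderNatAt_riemannXi_conj (ρ : ℂ) :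
    analyticOrderNatAt riemannXi ((starRingEnd ℂ) ρ) = analyticOrderNatAt riemannXi ρ := by
  obtain ⟨g, hg, hgρ, hfg⟩ :=
    exists_differentiable_eq_pow_mul differentiable_riemannXi riemannXi_one_ne_zero ρ
  refine analyticOrderNatAt_eq_of_eq_pow_mul
    (g := (starRingEnd ℂ) ∘ g ∘ (starRingEnd ℂ)) ?_ ?_ ?_
  · intro s
    have := (hg ((starRingEnd ℂ) s)).conj_conj
    rwa [Complex.conj_conj] at this
  · simpa using hgρ
  · intro s
    have := riemannXi_conj ((starRingEnd ℂ) s)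
    rw [Complex.conj_conj, hfg ((starRingEnd ℂ) s)] at this
    rw [this]
    simp

lemma zetaMult_eq {ρ : ℂ} (h : IsNontrivialZero ρ) :
    zetaMult ρ = analyticOrderNatAt riemannXi ρ := by
  have hρ1 : ρ ≠ 1 := by
    rintro rfl; have := h.2.2; simp at this
  have hρ0 : ρ ≠ 0 := by
    rintro rfl; have := h.2.1; simp at this
  have hz : AnalyticAt ℂ riemannZeta ρ := by
    refine DifferentiableOn.analyticAt differentiableOn_riemannZeta ?_
    exact isOpen_compl_singleton.mem_nhds hρ1
  have hre : {s : ℂ | 0 < s.re} ∈ nhds ρ :=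
    (isOpen_lt continuous_const continuous_re).mem_nhds h.2.1
  have hu : DifferentiableOn ℂ (fun s : ℂ => s * Gammaℝ s * (s - 1)) {s : ℂ | 0 < s.re} := by
    intro s hs
    have hs' : 0 < (s / 2).re := by simpa using hs
    have hG : DifferentiableAt ℂ Complex.Gamma (s / 2) := by
      refine Complex.differentiableAt_Gamma _ fun m hm => ?_
      rw [hm] at hs'
      simp at hs'
      linarith [(Nat.cast_nonneg m : (0 : ℝ) ≤ m)]
    have h1 : DifferentiableAt ℂ (fun s : ℂ => Complex.Gamma (s / 2)) s :=
      DifferentiableAt.comp s hG (by fun_prop)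
    have h2 : DifferentiableAt ℂ (fun s : ℂ => (π : ℂ) ^ (-s / 2)) s :=
      DifferentiableAt.const_cpow (by fun_prop) (Or.inl (by exact_mod_cast Real.pi_ne_zero))
    simp only [Gammaℝ_def]
    exact ((differentiableAt_id.mul (h2.mul h1)).mul (by fun_prop)).differentiableWithinAt
  have hua := hu.analyticAt hre
  have hu0 : ρ * Gammaℝ ρ * (ρ - 1) ≠ 0 :=
    mul_ne_zero (mul_ne_zero hρ0 (Gammaℝ_ne_zero_of_re_pos h.2.1)) (sub_ne_zero.2 hρ1)
  have hev : riemannXi =ᶠ[nhds ρ] (fun s : ℂ => s * Gammaℝ s * (s - 1)) * riemannZeta := by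
    filter_upwards [hre, isOpen_compl_singleton.mem_nhds hρ1] with s hs hs1
    rw [riemannXi_eq_mul hs, riemannZeta₁_eq_mul hs1, Pi.mul_apply]
    ring
  have hord : analyticOrderAt riemannXi ρ = analyticOrderAt riemannZeta ρ := by
    rw [analyticOrderAt_congr hev, analyticOrderAt_mul hua hz, hua.analyticOrderAt_eq_zero.2 hu0,
      zero_add]
  have hfin : analyticOrderAt riemannZeta ρ = analyticOrderNatAt riemannXi ρ := by
    rw [← hord, Nat.cast_analyticOrderNatAt
      (differentiable_riemannXi.analyticOrderAt_ne_top riemannXi_one_ne_zero ρ)]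
  obtain ⟨h1, h2⟩ := (analyticOrderAt_eq_nat_iff_iteratedDeriv_eq_zero hz).1 hfin
  refine le_antisymm (Nat.sInf_le h2) (le_csInf ⟨_, h2⟩ fun n hn => ?_)
  by_contra! hlt
  exact hn (h1 n hlt)

/-- The zeros of `ξ` in the closed disc of radius `R` about the centre of symmetry. -/
def xiZeros (R : ℝ) : Finset ℂ :=
  (differentiable_riemannXi.finite_zeros_inter_closedBall riemannXi_one_ne_zero (1 / 2) R).toFinset

lemma mem_xiZeros {R : ℝ} {ρ : ℂ} : ρ ∈ xiZeros R ↔ riemannXi ρ = 0 ∧ ‖ρ - 1 / 2‖ ≤ R := by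
  simp [xiZeros, dist_eq_norm]

lemma one_sub_mem_xiZeros {R : ℝ} {ρ : ℂ} (h : ρ ∈ xiZeros R) : 1 - ρ ∈ xiZeros R := by
  rw [mem_xiZeros] at *
  refine ⟨by rw [riemannXi_one_sub, h.1], ?_⟩
  rw [show (1 - ρ - 1 / 2 : ℂ) = -(ρ - 1 / 2) by ring, norm_neg]
  exact h.2

lemma conj_mem_xiZeros {R : ℝ} {ρ : ℂ} (h : ρ ∈ xiZeros R) :
    (starRingEnd ℂ) ρ ∈ xiZeros R := by
  rw [mem_xiZeros] at *
  refine ⟨by rw [riemannXi_conj, h.1, map_zero], ?_⟩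
  have e : (starRingEnd ℂ) ρ - 1 / 2 = (starRingEnd ℂ) (ρ - 1 / 2) := by simp [Complex.conj_two]
  rw [e, RCLike.norm_conj]
  exact h.2

lemma Finset.sum_comp_of_involutive {M : Type*} [AddCommMonoid M] {σ : ℂ → ℂ}
    (hσ : Function.Involutive σ) {Z : Finset ℂ} (hZ : ∀ a ∈ Z, σ a ∈ Z) (F : ℂ → M) :
    ∑ a ∈ Z, F (σ a) = ∑ a ∈ Z, F a :=
  Finset.sum_nbij' σ σ hZ hZ (fun a _ => hσ a) (fun a _ => hσ a) fun _ _ => rfl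

lemma sum_one_sub_xiZeros {R : ℝ} {M : Type*} [AddCommMonoid M] (F : ℂ → M) :
    ∑ a ∈ xiZeros R, F (1 - a) = ∑ a ∈ xiZeros R, F a :=
  Finset.sum_comp_of_involutive (fun a => sub_sub_cancel 1 a) (fun _ => one_sub_mem_xiZeros) F

lemma sum_conj_xiZeros {R : ℝ} {M : Type*} [AddCommMonoid M] (F : ℂ → M) :
    ∑ a ∈ xiZeros R, F ((starRingEnd ℂ) a) = ∑ a ∈ xiZeros R, F a :=
  Finset.sum_comp_of_involutive (fun a => Complex.conj_conj a) (fun _ => conj_mem_xiZeros) F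

lemma Finset.prod_comp_of_involutive {M : Type*} [CommMonoid M] {σ : ℂ → ℂ}
    (hσ : Function.Involutive σ) {Z : Finset ℂ} (hZ : ∀ a ∈ Z, σ a ∈ Z) (F : ℂ → M) :
    ∏ a ∈ Z, F (σ a) = ∏ a ∈ Z, F a :=
  Finset.prod_nbij' σ σ hZ hZ (fun a _ => hσ a) (fun a _ => hσ a) fun _ _ => rfl

/-- The product of the linear factors of `ξ` over its zeros in a disc. -/
def xiProd (R : ℝ) (s : ℂ) : ℂ := ∏ a ∈ xiZeros R, (s - a) ^ analyticOrderNatAt riemannXi a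

lemma xiProd_one_sub (R : ℝ) (s : ℂ) :
    xiProd R (1 - s) = (-1) ^ (∑ a ∈ xiZeros R, analyticOrderNatAt riemannXi a) * xiProd R s := by
  rw [xiProd, xiProd, ← Finset.prod_pow_eq_pow_sum]
  rw [← Finset.prod_comp_of_involutive (fun a => sub_sub_cancel 1 a) (fun _ => one_sub_mem_xiZeros)
    (fun a => (1 - s - a) ^ analyticOrderNatAt riemannXi a), ← Finset.prod_mul_distrib]
  refine Finset.prod_congr rfl fun a _ => ?_
  rw [analyticOrderNatAt_riemannXi_one_sub, ← mul_pow]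
  congr 1; ring

lemma xiProd_conj (R : ℝ) (s : ℂ) :
    xiProd R ((starRingEnd ℂ) s) = (starRingEnd ℂ) (xiProd R s) := by
  rw [xiProd, xiProd, map_prod]
  rw [← Finset.prod_comp_of_involutive (fun a => Complex.conj_conj a) (fun _ => conj_mem_xiZeros)
    (fun a => ((starRingEnd ℂ) s - a) ^ analyticOrderNatAt riemannXi a)]
  refine Finset.prod_congr rfl fun a _ => ?_
  rw [analyticOrderNatAt_riemannXi_conj, map_pow, map_sub]

lemma xiProd_ne_zero {R : ℝ} {s : ℂ} (hs : s ∉ xiZeros R) : xiProd R s ≠ 0 :=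
  Finset.prod_ne_zero_iff.2 fun _ ha => pow_ne_zero _ (sub_ne_zero.2 fun h => hs (h ▸ ha))

lemma eq_of_xiProd_mul_eq {R : ℝ} {u v : ℂ → ℂ} (hu : Continuous u) (hv : Continuous v)
    (h : ∀ s, xiProd R s * u s = xiProd R s * v s) : u = v := by
  refine hu.ext_on ((xiZeros R).finite_toSet.countable.dense_compl ℝ) hv fun s hs => ?_
  exact mul_left_cancel₀ (xiProd_ne_zero (by simpa using hs)) (h s)

/-- A logarithm of the zero-free part of `ξ` on a disc, which is real on the real axis and on the
critical line up to the same constant. -/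
lemma exists_log_xi_div_xiProd {R : ℝ} (hR : 2 < R) :
    ∃ h : ℂ → ℂ, ContinuousOn h (Metric.ball (1 / 2) R) ∧
      (∀ s ∈ Metric.ball (1 / 2) R, riemannXi s = xiProd R s * Complex.exp (h s)) ∧
      ∀ T : ℝ, 1 / 2 + T * I ∈ Metric.ball (1 / 2 : ℂ) R → (h (1 / 2 + T * I)).im = (h 2).im := by
  obtain ⟨g, hg, hgZ, hfg⟩ := exists_differentiable_eq_prod_mul differentiable_riemannXi
    riemannXi_one_ne_zero (xiZeros R)
  have hfg' : ∀ s, riemannXi s = xiProd R s * g s := hfg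
  have hg0 : ∀ s ∈ Metric.ball (1 / 2) R, g s ≠ 0 := by
    intro s hs h0
    refine hgZ s (mem_xiZeros.2 ⟨by rw [hfg', h0, mul_zero], ?_⟩) h0
    exact (mem_ball_iff_norm.1 hs).le
  obtain ⟨h, hhd, hh⟩ := exists_differentiableOn_log hg (by linarith) hg0
  set n := ∑ a ∈ xiZeros R, analyticOrderNatAt riemannXi a with hn
  have hsymm : ∀ s, g (1 - s) = (-1) ^ n * g s := by
    refine congrFun (eq_of_xiProd_mul_eq (R := R) (hg.continuous.comp (by fun_prop))
      (continuous_const.mul hg.continuous) fun s => ?_)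
    have h1 := riemannXi_one_sub s
    rw [hfg', hfg', xiProd_one_sub] at h1
    have h2 : ((-1 : ℂ) ^ n) * (-1) ^ n = 1 := by rw [← mul_pow]; simp
    show xiProd R s * g (1 - s) = xiProd R s * ((-1) ^ n * g s)
    calc _ = ((-1) ^ n * (-1) ^ n) * (xiProd R s * g (1 - s)) := by rw [h2, one_mul]
      _ = (-1) ^ n * (xiProd R s * g s) := by rw [← h1]; ring
      _ = _ := by ring
  have hconj : ∀ s, (starRingEnd ℂ) (g ((starRingEnd ℂ) s)) = g s := by
    refine congrFun (eq_of_xiProd_mul_eq (R := R)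
      (Complex.continuous_conj.comp (hg.continuous.comp Complex.continuous_conj))
      hg.continuous fun s => ?_)
    have h1 := congrArg (starRingEnd ℂ) (riemannXi_conj s)
    rw [hfg', xiProd_conj, map_mul, Complex.conj_conj, Complex.conj_conj, hfg'] at h1
    exact h1
  have hpre : IsPreconnected (Metric.ball (1 / 2 : ℂ) R) := (convex_ball _ _).isPreconnected
  have hone : ∀ s ∈ Metric.ball (1 / 2 : ℂ) R, 1 - s ∈ Metric.ball (1 / 2 : ℂ) R := by
    intro s hs
    rw [mem_ball_iff_norm] at *
    rwa [show (1 - s - 1 / 2 : ℂ) = -(s - 1 / 2) by ring, norm_neg]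
  have hcb : ∀ s ∈ Metric.ball (1 / 2 : ℂ) R, (starRingEnd ℂ) s ∈ Metric.ball (1 / 2 : ℂ) R := by
    intro s hs
    rw [mem_ball_iff_norm] at *
    have e : (starRingEnd ℂ) s - 1 / 2 = (starRingEnd ℂ) (s - 1 / 2) := by simp [Complex.conj_two]
    rwa [e, RCLike.norm_conj]
  have hhalf : (1 / 2 : ℂ) ∈ Metric.ball (1 / 2 : ℂ) R := Metric.mem_ball_self (by linarith)
  have htwo : (2 : ℂ) ∈ Metric.ball (1 / 2 : ℂ) R := by
    rw [mem_ball_iff_norm]; norm_num; linarith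
  have hexpn : Complex.exp (n * (π * I)) = (-1) ^ n := by
    rw [Complex.exp_nat_mul, Complex.exp_pi_mul_I]
  refine ⟨h, hhd.continuousOn, fun s hs => by rw [hfg', hh s hs], fun T hT => ?_⟩
  have e1 := sub_eq_sub_of_exp_eq hpre (F := fun s => h (1 - s)) (G := fun s => h s + n * (π * I))
    (hhd.continuousOn.comp (by fun_prop) hone) (hhd.continuousOn.add continuousOn_const)
    (fun s hs => by
      show Complex.exp (h (1 - s)) = Complex.exp (h s + n * (π * I))
      rw [hh _ (hone s hs), hsymm, Complex.exp_add, hh s hs, hexpn, mul_comm]) hT hhalf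
  have e2 := sub_eq_sub_of_exp_eq hpre
    (F := fun s => (starRingEnd ℂ) (h ((starRingEnd ℂ) s))) (G := h)
    (Complex.continuous_conj.comp_continuousOn
      (hhd.continuousOn.comp Complex.continuous_conj.continuousOn hcb)) hhd.continuousOn
    (fun s hs => by
      show Complex.exp ((starRingEnd ℂ) (h ((starRingEnd ℂ) s))) = Complex.exp (h s)
      rw [Complex.exp_conj, hh _ (hcb s hs), hconj, hh s hs]) hT htwo
  have e3 : (1 - 1 / 2 : ℂ) = 1 / 2 := by norm_num
  have e4 : (starRingEnd ℂ) (1 / 2 + T * I) = 1 - (1 / 2 + T * I) := by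
    apply Complex.ext <;> (simp; try norm_num)
  simp only [e3] at e1
  simp only [e4, Complex.conj_two] at e2
  have i1 := congrArg Complex.im e1
  have i2 := congrArg Complex.im e2
  simp only [sub_im, add_im, conj_im] at i1 i2
  linarith

lemma IsNontrivialZero.mem_xiZeros {ρ : ℂ} {R : ℝ} (h : IsNontrivialZero ρ)
    (hR : |ρ.im| + 1 / 2 ≤ R) : ρ ∈ xiZeros R := by
  refine _root_.mem_xiZeros.2 ⟨(riemannXi_eq_zero_iff ρ).2 h, ?_⟩
  have h1 := Complex.norm_le_abs_re_add_abs_im (ρ - 1 / 2)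
  have h2 : |(ρ - 1 / 2).re| ≤ 1 / 2 := by
    have e : (ρ - 1 / 2).re = ρ.re - 1 / 2 := by simp
    rw [e, abs_le]
    constructor <;> linarith [h.2.1, h.2.2]
  have h3 : (ρ - 1 / 2).im = ρ.im := by simp
  rw [h3] at h1
  linarith

lemma Ncount_eq_sum {T R : ℝ} (hR : T + 1 / 2 ≤ R) :
    Ncount T = ∑ a ∈ xiZeros R with 0 < a.im ∧ a.im ≤ T, (analyticOrderNatAt riemannXi a : ℝ) := by
  rw [← Finset.tsum_subtype, Ncount]
  have hset : ∀ ρ : ℂ, (IsNontrivialZero ρ ∧ 0 < ρ.im ∧ ρ.im ≤ T) ↔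
      ρ ∈ (xiZeros R).filter (fun a => 0 < a.im ∧ a.im ≤ T) := by
    intro ρ
    rw [Finset.mem_filter]
    refine and_congr_left fun h => ⟨fun hρ => hρ.mem_xiZeros ?_, fun hρ => ?_⟩
    · rw [abs_of_pos h.1]; linarith [h.2]
    · exact (riemannXi_eq_zero_iff ρ).1 (mem_xiZeros.1 hρ).1
  rw [← (Equiv.subtypeEquivRight hset).tsum_eq]
  refine tsum_congr fun ρ => ?_
  rw [zetaMult_eq ρ.2.1]
  rfl

lemma xiZeros_re {R : ℝ} {a : ℂ} (ha : a ∈ xiZeros R) : 0 < a.re ∧ a.re < 1 :=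
  ((riemannXi_eq_zero_iff a).1 (mem_xiZeros.1 ha).1).2

lemma sum_arg_two_sub_xiZeros (R : ℝ) :
    ∑ a ∈ xiZeros R, (analyticOrderNatAt riemannXi a : ℝ) * (2 - a).arg = 0 := by
  have h := sum_conj_xiZeros (R := R)
    (fun a => (analyticOrderNatAt riemannXi a : ℝ) * (2 - a).arg)
  have h2 : ∑ a ∈ xiZeros R, (analyticOrderNatAt riemannXi ((starRingEnd ℂ) a) : ℝ) *
      (2 - (starRingEnd ℂ) a).arg =
      -∑ a ∈ xiZeros R, (analyticOrderNatAt riemannXi a : ℝ) * (2 - a).arg := by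
    rw [← Finset.sum_neg_distrib]
    refine Finset.sum_congr rfl fun a ha => ?_
    have e : 2 - (starRingEnd ℂ) a = (starRingEnd ℂ) (2 - a) := by simp [Complex.conj_two]
    have hne : (2 - a).arg ≠ π := by
      have : 0 < (2 - a).re := by
        have := (xiZeros_re ha).2
        simp; linarith
      have := (abs_lt.1 (Complex.abs_arg_lt_pi_div_two_iff.2 (Or.inl this))).2
      linarith [Real.pi_pos]
    rw [analyticOrderNatAt_riemannXi_conj, e, Complex.arg_conj, if_neg hne]
    ring
  linarith

lemma Complex.arg_add_arg_neg_conj {w : ℂ} (hw : w.im ≠ 0) :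
    w.arg + (-(starRingEnd ℂ) w).arg = π * SignType.sign w.im := by
  have hne : w.arg ≠ π := fun h => hw (Complex.arg_eq_pi_iff.1 h).2
  have hc : ((starRingEnd ℂ) w).arg = -w.arg := by rw [Complex.arg_conj, if_neg hne]
  rcases lt_or_gt_of_ne hw with h | h
  · rw [Complex.arg_neg_eq_arg_sub_pi_of_im_pos (by simpa using h), hc, sign_neg h]
    simp
    ring
  · rw [Complex.arg_neg_eq_arg_add_pi_of_im_neg (by simpa using h), hc, sign_pos h]
    simp

lemma sum_arg_half_sub_xiZeros {T R : ℝ} (hT : 0 < T) (hR : T + 1 / 2 ≤ R)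
    (hord : ∀ a, riemannXi a = 0 → a.im ≠ T) :
    ∑ a ∈ xiZeros R, (analyticOrderNatAt riemannXi a : ℝ) * (1 / 2 + T * I - a).arg =
      π * Ncount T := by
  set m : ℂ → ℝ := fun a => (analyticOrderNatAt riemannXi a : ℝ) with hm
  have hmc : ∀ a, m ((starRingEnd ℂ) a) = m a := fun a => by
    simp only [hm, analyticOrderNatAt_riemannXi_conj]
  have hm1 : ∀ a, m (1 - a) = m a := fun a => by
    simp only [hm, analyticOrderNatAt_riemannXi_one_sub]
  have hz : ∀ {a}, a ∈ xiZeros R → riemannXi a = 0 := fun ha => (mem_xiZeros.1 ha).1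
  have hz' : ∀ {a}, a ∈ xiZeros R → -a.im ≠ T := fun {a} ha => by
    have := hord ((starRingEnd ℂ) a) (by rw [riemannXi_conj, hz ha, map_zero])
    simpa using this
  -- reflection in the critical line
  have h1 : ∑ a ∈ xiZeros R, m a * (1 / 2 + T * I - a).arg =
      ∑ a ∈ xiZeros R, m a * (-(starRingEnd ℂ) (1 / 2 + T * I - a)).arg := by
    rw [← sum_one_sub_xiZeros, ← sum_conj_xiZeros]
    refine Finset.sum_congr rfl fun a _ => ?_
    rw [hm1, hmc]
    congr 2
    apply Complex.ext <;> simp <;> ring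
  have h2 : 2 * ∑ a ∈ xiZeros R, m a * (1 / 2 + T * I - a).arg =
      π * ∑ a ∈ xiZeros R, m a * (SignType.sign (T - a.im) : ℝ) := by
    rw [two_mul]
    nth_rewrite 2 [h1]
    rw [← Finset.sum_add_distrib, Finset.mul_sum]
    refine Finset.sum_congr rfl fun a ha => ?_
    have e : (1 / 2 + T * I - a).im = T - a.im := by simp
    rw [← mul_add, Complex.arg_add_arg_neg_conj
      (by rw [e]; exact sub_ne_zero.2 (hord a (hz ha)).symm), e]
    ring
  have h3 : ∑ a ∈ xiZeros R, m a * (SignType.sign (T - a.im) : ℝ) =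
      ∑ a ∈ xiZeros R, m a * (SignType.sign (T + a.im) : ℝ) := by
    rw [← sum_conj_xiZeros]
    refine Finset.sum_congr rfl fun a _ => ?_
    rw [hmc]; simp
  have hN : Ncount T = ∑ a ∈ xiZeros R, m a * (if 0 < a.im ∧ a.im ≤ T then 1 else 0) := by
    rw [Ncount_eq_sum hR, Finset.sum_filter]
    refine Finset.sum_congr rfl fun a _ => ?_
    split_ifs <;> simp [hm]
  have hN' : Ncount T = ∑ a ∈ xiZeros R, m a * (if 0 < -a.im ∧ -a.im ≤ T then 1 else 0) := by
    rw [hN, ← sum_conj_xiZeros]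
    refine Finset.sum_congr rfl fun a _ => ?_
    rw [hmc, Complex.conj_im]
  have h4 : ∑ a ∈ xiZeros R, m a * (SignType.sign (T - a.im) : ℝ) +
      ∑ a ∈ xiZeros R, m a * (SignType.sign (T + a.im) : ℝ) = 2 * Ncount T + 2 * Ncount T := by
    nth_rewrite 1 [hN]
    rw [hN', Finset.mul_sum, Finset.mul_sum, ← Finset.sum_add_distrib, ← Finset.sum_add_distrib]
    refine Finset.sum_congr rfl fun a ha => ?_
    have a1 := hord a (hz ha)
    have a2 := hz' ha
    have a3 : a.im ≠ 0 := by
      have := ((riemannXi_eq_zero_iff a).1 (hz ha)).abs_im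
      intro h0
      rw [h0, abs_zero] at this
      linarith
    rcases lt_or_gt_of_ne a1 with b1 | b1 <;> rcases lt_or_gt_of_ne a2 with b2 | b2 <;>
      rcases lt_or_gt_of_ne a3 with b3 | b3
    all_goals first
      | (exfalso; linarith)
      | skip
    all_goals
      first
        | rw [sign_pos (show 0 < T - a.im by linarith)]
        | rw [sign_neg (show T - a.im < 0 by linarith)]
      first
        | rw [sign_pos (show 0 < T + a.im by linarith)]
        | rw [sign_neg (show T + a.im < 0 by linarith)]
      first
        | rw [if_pos (show 0 < a.im ∧ a.im ≤ T from ⟨by linarith, by linarith⟩)]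
        | rw [if_neg (show ¬ (0 < a.im ∧ a.im ≤ T) from fun h => by linarith [h.1, h.2])]
      first
        | rw [if_pos (show 0 < -a.im ∧ -a.im ≤ T from ⟨by linarith, by linarith⟩)]
        | rw [if_neg (show ¬ (0 < -a.im ∧ -a.im ≤ T) from fun h => by linarith [h.1, h.2])]
      simp
      try ring
  rw [← h3] at h4
  linear_combination (1 / 2 : ℝ) * h2 + (π / 4) * h4

lemma riemannZeta_mem_slitPlane {s : ℂ} (hs : 2 ≤ s.re) : riemannZeta s ∈ slitPlane := by
  have h1 := (norm_riemannZeta_sub_one_le hs).trans_lt pi_sq_div_six_sub_one_lt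
  have h2 := (abs_le.1 (Complex.abs_re_le_norm (riemannZeta s - 1))).1
  rw [sub_re, one_re] at h2
  exact Or.inl (by linarith)

/-- The Riemann–von Mangoldt formula away from ordinates of zeros. -/
lemma exists_abs_Ncount_sub_le_of_not_ordinate :
    ∃ K : ℝ, ∀ T : ℝ, 2 ≤ T → (∀ a, riemannXi a = 0 → a.im ≠ T) →
      |Ncount T - (T / (2 * π) * Real.log (T / (2 * π)) - T / (2 * π))| ≤
        300 * (Real.log (10 * (T + 5) ^ 3) + 1) + K := by
  refine ⟨|(logGammaSeries 1).im| + 20, fun T hT hord => ?_⟩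
  set R := T + 3 with hR
  obtain ⟨h, hhc, hh, hhim⟩ := exists_log_xi_div_xiProd (R := R) (by linarith)
  set m := analyticOrderNatAt riemannXi with hm
  set W : ℂ → ℂ := fun s => h s + ∑ a ∈ xiZeros R, (m a : ℂ) * Complex.log (s - a) -
    Complex.log s + s / 2 * Real.log π - logGammaSeries (s / 2) with hW
  set U : Set ℂ := {s | s ∈ Metric.ball (1 / 2 : ℂ) R ∧ 0 < s.re ∧
    ∀ a ∈ xiZeros R, s - a ∈ slitPlane} with hU
  have hWc : ContinuousOn W U := by
    refine ((((hhc.mono fun s hs => hs.1).add (continuousOn_finsetSum _ fun a ha => ?_)).sub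
      ?_).add (by fun_prop)).sub ?_
    · refine continuousOn_const.mul fun s hs => ?_
      exact ((continuousAt_id.sub continuousAt_const).clog (hs.2.2 a ha)).continuousWithinAt
    · exact fun s hs => (continuousAt_id.clog (Or.inl hs.2.1)).continuousWithinAt
    · refine continuousOn_logGammaSeries.comp (by fun_prop) fun s hs => ?_
      have := hs.2.1
      simp
      linarith
  have hWexp : ∀ s ∈ U, Complex.exp (W s) = riemannZeta₁ s := by
    intro s hs
    have hs0 : s ≠ 0 := fun h0 => by have := hs.2.1; simp [h0] at this
    have hre : 0 < (s / 2).re := by have := hs.2.1; simp; linarith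
    have hprod : Complex.exp (∑ a ∈ xiZeros R, (m a : ℂ) * Complex.log (s - a)) = xiProd R s := by
      rw [Complex.exp_sum, xiProd]
      refine Finset.prod_congr rfl fun a ha => ?_
      rw [Complex.exp_nat_mul, Complex.exp_log (slitPlane_ne_zero (hs.2.2 a ha))]
    have hpi : Complex.exp (s / 2 * Real.log π) * (π : ℂ) ^ (-s / 2) = 1 := by
      rw [Complex.cpow_def_of_ne_zero (by exact_mod_cast Real.pi_ne_zero), ← Complex.exp_add,
        Complex.ofReal_log Real.pi_pos.le]
      rw [show s / 2 * Complex.log π + Complex.log π * (-s / 2) = 0 by ring, Complex.exp_zero]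
    have hxi := riemannXi_eq_mul hs.2.1
    rw [hh s hs.1, Gammaℝ_def] at hxi
    have hG : Complex.Gamma (s / 2) ≠ 0 := Complex.Gamma_ne_zero_of_re_pos hre
    have hE : Complex.exp (W s) = Complex.exp (h s) * xiProd R s / s *
        Complex.exp (s / 2 * Real.log π) / Complex.Gamma (s / 2) := by
      simp only [hW]
      rw [Complex.exp_sub, Complex.exp_add, Complex.exp_sub, Complex.exp_add, hprod,
        Complex.exp_log hs0, exp_logGammaSeries hre]
    rw [hE, mul_comm (Complex.exp (h s)), hxi]
    calc _ = (Complex.exp (s / 2 * Real.log π) * (π : ℂ) ^ (-s / 2)) * riemannZeta₁ s *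
        (s / s) * (Complex.Gamma (s / 2) / Complex.Gamma (s / 2)) := by ring
      _ = _ := by rw [hpi, div_self hs0, div_self hG, one_mul, mul_one, mul_one]
  have him : ∀ s, (W s).im = (h s).im + ∑ a ∈ xiZeros R, (m a : ℝ) * (s - a).arg -
      s.arg + s.im / 2 * Real.log π - (logGammaSeries (s / 2)).im := by
    intro s
    simp only [hW, sub_im, add_im, Complex.log_im, Complex.im_sum]
    congr 2
    · congr 2
      refine Finset.sum_congr rfl fun a _ => ?_
      rw [← Complex.ofReal_natCast, Complex.im_ofReal_mul, Complex.log_im]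
    · rw [Complex.im_mul_ofReal]
      simp
  have hball : ∀ {s : ℂ}, 1 / 2 ≤ s.re → s.re ≤ 2 → 0 ≤ s.im → s.im ≤ T →
      s ∈ Metric.ball (1 / 2 : ℂ) R := by
    intro s h1 h2 h3 h4
    rw [mem_ball_iff_norm]
    have k1 := Complex.norm_le_abs_re_add_abs_im (s - 1 / 2)
    have k2 : (s - 1 / 2).re = s.re - 1 / 2 := by simp
    have k3 : (s - 1 / 2).im = s.im := by simp
    rw [k2, k3, abs_of_nonneg (by linarith), abs_of_nonneg h3] at k1
    linarith
  -- the vertical side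
  set A₁ : Set ℂ := {s | s.re = 2 ∧ s.im ∈ Icc 0 T} with hA₁
  have hA₁U : A₁ ⊆ U := by
    rintro s ⟨h1, h2, h3⟩
    refine ⟨hball (by linarith) h1.le h2 h3, by linarith, fun a ha => Or.inl ?_⟩
    have := (xiZeros_re ha).2
    rw [sub_re]; linarith
  have hA₁p : IsPreconnected A₁ := by
    exact (((convex_singleton (2 : ℝ)).linear_preimage Complex.reLm).inter
      ((convex_Icc 0 T).linear_preimage Complex.imLm)).isPreconnected
  have hA₁s : ∀ s ∈ A₁, s - 1 ∈ slitPlane := by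
    rintro s ⟨h1, -⟩
    exact Or.inl (by simp; linarith)
  have hmem2 : (2 : ℂ) ∈ A₁ := ⟨by simp, by simp; linarith⟩
  have hmem2T : (2 + T * I : ℂ) ∈ A₁ := ⟨by simp, by simp; linarith⟩
  have v1 := sub_eq_sub_of_exp_eq hA₁p (F := W)
    (G := fun s => Complex.log (s - 1) + Complex.log (riemannZeta s)) (hWc.mono hA₁U)
    (by
      intro s hs
      refine ContinuousAt.continuousWithinAt (ContinuousAt.add ?_ ?_)
      · exact (continuousAt_id.sub continuousAt_const).clog (hA₁s s hs)
      · refine ContinuousAt.clog (differentiableAt_riemannZeta ?_).continuousAt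
          (riemannZeta_mem_slitPlane hs.1.ge)
        rintro rfl
        have := hs.1
        norm_num at this)
    (fun s hs => by
      have hs1 : s ≠ 1 := by
        rintro rfl
        have := hs.1
        norm_num at this
      show Complex.exp (W s) = Complex.exp (Complex.log (s - 1) + Complex.log (riemannZeta s))
      rw [hWexp s (hA₁U hs), Complex.exp_add, Complex.exp_log (sub_ne_zero.2 hs1),
        Complex.exp_log (slitPlane_ne_zero (riemannZeta_mem_slitPlane hs.1.ge)),
        riemannZeta₁_eq_mul hs1]) hmem2T hmem2
  have v2 := congrArg Complex.im v1
  simp only [sub_im, add_im, Complex.log_im] at v2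
  have hargle : ∀ z : ℂ, |z.arg| ≤ 4 := fun z => (Complex.abs_arg_le_pi z).trans Real.pi_le_four
  have b1 := abs_le.1 (hargle (2 + T * I - 1))
  have b2 := abs_le.1 (hargle (riemannZeta (2 + T * I)))
  have b3 := abs_le.1 (hargle (riemannZeta 2))
  have b4 := abs_le.1 (hargle (1 / 2 + T * I))
  have b5 : ((2 : ℂ) - 1).arg = 0 := by norm_num
  -- the horizontal side
  set A₂ : Set ℂ := {s | s.im = T ∧ s.re ∈ Icc (1 / 2 : ℝ) 2} with hA₂
  have hA₂U : A₂ ⊆ U := by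
    rintro s ⟨h1, h2, h3⟩
    refine ⟨hball h2 h3 (by linarith) h1.le, by linarith, fun a ha => Or.inr ?_⟩
    rw [sub_im, h1]
    exact sub_ne_zero.2 (hord a (mem_xiZeros.1 ha).1).symm
  have hA₂p : IsPreconnected A₂ := by
    exact (((convex_singleton T).linear_preimage Complex.imLm).inter
      ((convex_Icc (1 / 2 : ℝ) 2).linear_preimage Complex.reLm)).isPreconnected
  have hz := abs_im_log_riemannZeta₁_sub_le hT (fun s hs hsT h0 => hord s (by
    rw [riemannXi_eq_mul hs, h0, mul_zero]) hsT) hA₂p (fun s hs => hs.1) (fun s hs => hs.2)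
    (hWc.mono hA₂U) (fun s hs => hWexp s (hA₂U hs)) ⟨by simp, by simp; norm_num⟩
    ⟨by simp, by simp; norm_num⟩
  have g := abs_im_logGammaSeries_quarter_sub_le (y := T / 2) (by linarith)
  have w1 := him (1 / 2 + T * I)
  have w2 := him 2
  rw [sum_arg_half_sub_xiZeros (by linarith) (by linarith) hord,
    hhim T (hball (by simp) (by simp; norm_num) (by simp; linarith) (by simp))] at w1
  rw [sum_arg_two_sub_xiZeros, show (2 : ℂ).arg = 0 from Complex.ofNat_arg,
    show (2 : ℂ).im = 0 by simp, show (2 / 2 : ℂ) = 1 by norm_num] at w2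
  rw [show ((1 / 2 + T * I) / 2 : ℂ) = 1 / 4 + (T / 2 : ℝ) * I by push_cast; ring,
    show (1 / 2 + T * I : ℂ).im = T by simp] at w1
  have hlog : T / (2 * π) * Real.log (T / (2 * π)) - T / (2 * π) =
      (T / 2 * Real.log (T / 2) - T / 2 - T / 2 * Real.log π) / π := by
    rw [show T / (2 * π) = T / 2 / π by field_simp,
      Real.log_div (by linarith) Real.pi_ne_zero]
    ring
  rw [hlog]
  have e : Ncount T - (T / 2 * Real.log (T / 2) - T / 2 - T / 2 * Real.log π) / π =
      (π * Ncount T - (T / 2 * Real.log (T / 2) - T / 2 - T / 2 * Real.log π)) / π := by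
    field_simp
  rw [e, abs_div, abs_of_pos Real.pi_pos]
  refine (div_le_self (abs_nonneg _) (by linarith [Real.pi_gt_three])).trans ?_
  have l1 := neg_abs_le (logGammaSeries 1).im
  have l2 := le_abs_self (logGammaSeries 1).im
  obtain ⟨z1, z2⟩ := abs_le.1 hz
  obtain ⟨g1, g2⟩ := abs_le.1 g
  rw [b5] at v2
  rw [abs_le]
  constructor <;> linarith

lemma hasSum_Ncount (x : ℝ) :
    HasSum (fun ρ : {ρ : ℂ // IsNontrivialZero ρ ∧ 0 < ρ.im} =>
      (zetaMult ρ.1 : ℝ) * if ρ.1.im ≤ x then 1 else 0) (Ncount x) := by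
  set Z : Set ℂ := {ρ | IsNontrivialZero ρ ∧ 0 < ρ.im} with hZ
  refine (hasSum_subtype_iff_indicator (s := Z)
    (f := fun ρ : ℂ => (zetaMult ρ : ℝ) * if ρ.im ≤ x then 1 else 0)).2 ?_
  rw [Ncount_eq_sum (le_refl (x + 1 / 2))]
  set F := (xiZeros (x + 1 / 2)).filter (fun a => 0 < a.im ∧ a.im ≤ x) with hF
  have hFZ : ∀ a ∈ F, IsNontrivialZero a ∧ 0 < a.im ∧ a.im ≤ x := fun a ha => by
    rw [hF, Finset.mem_filter] at ha
    exact ⟨(riemannXi_eq_zero_iff a).1 (mem_xiZeros.1 ha.1).1, ha.2⟩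
  have hsum : ∑ a ∈ F, (analyticOrderNatAt riemannXi a : ℝ) =
      ∑ a ∈ F, Z.indicator (fun ρ : ℂ => (zetaMult ρ : ℝ) * if ρ.im ≤ x then 1 else 0) a := by
    refine Finset.sum_congr rfl fun a ha => ?_
    obtain ⟨h1, h2, h3⟩ := hFZ a ha
    rw [indicator_of_mem (show a ∈ Z from ⟨h1, h2⟩), if_pos h3, mul_one, zetaMult_eq h1]
  rw [hsum]
  refine hasSum_sum_of_ne_finset_zero fun a ha => ?_
  by_cases haZ : a ∈ Z
  · rw [indicator_of_mem haZ, if_neg, mul_zero]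
    intro hax
    refine ha (Finset.mem_filter.2 ⟨haZ.1.mem_xiZeros ?_, haZ.2, hax⟩)
    rw [abs_of_pos haZ.2]
    linarith
  · exact indicator_of_notMem haZ _

lemma Ncount_mono : Monotone Ncount := by
  intro x y hxy
  refine hasSum_le (fun ρ => ?_) (hasSum_Ncount x) (hasSum_Ncount y)
  refine mul_le_mul_of_nonneg_left ?_ (Nat.cast_nonneg _)
  split_ifs <;> norm_num
  linarith

lemma Ncount_nonneg (x : ℝ) : 0 ≤ Ncount x := tsum_nonneg fun _ => Nat.cast_nonneg _

lemma countable_zeros_riemannXi : {a | riemannXi a = 0}.Countable := by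
  have h : {a | riemannXi a = 0} ⊆ ⋃ n : ℕ, (xiZeros n : Set ℂ) := by
    intro a ha
    obtain ⟨n, hn⟩ := exists_nat_ge ‖a - 1 / 2‖
    exact mem_iUnion.2 ⟨n, mem_xiZeros.2 ⟨ha, hn⟩⟩
  exact (countable_iUnion fun n : ℕ => (xiZeros n).countable_toSet).mono h

/-- The main term of the Riemann–von Mangoldt formula. -/
def mainTerm (T : ℝ) : ℝ := T / (2 * π) * Real.log (T / (2 * π)) - T / (2 * π)

lemma continuous_mainTerm : Continuous mainTerm := by
  have h : Continuous fun T : ℝ => T / (2 * π) := by fun_prop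
  exact (Real.continuous_mul_log.comp h).sub h

lemma exists_abs_Ncount_sub_mainTerm_le :
    ∃ K : ℝ, ∀ T : ℝ, 2 < T →
      |Ncount T - mainTerm T| ≤ 300 * (Real.log (10 * (T + 6) ^ 3) + 1) + K := by
  obtain ⟨K, hK⟩ := exists_abs_Ncount_sub_le_of_not_ordinate
  refine ⟨K + 1, fun T hT => ?_⟩
  have hd : Dense (Complex.im '' {a | riemannXi a = 0})ᶜ :=
    (countable_zeros_riemannXi.image _).dense_compl ℝ
  obtain ⟨ε, hε, hcont⟩ := Metric.continuous_iff.1 continuous_mainTerm T 1 one_pos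
  have hbound : ∀ T' ∈ (Complex.im '' {a | riemannXi a = 0})ᶜ, 2 ≤ T' → T' ≤ T + 1 →
      |T' - T| < ε → |Ncount T' - mainTerm T| ≤
        300 * (Real.log (10 * (T + 6) ^ 3) + 1) + (K + 1) := by
    intro T' h1 h2 h3 h4
    have k1 := hK T' h2 fun a ha hT' => h1 ⟨a, ha, hT'⟩
    have k2 : |mainTerm T' - mainTerm T| < 1 := hcont T' h4
    have k3 : Real.log (10 * (T' + 5) ^ 3) ≤ Real.log (10 * (T + 6) ^ 3) := by
      refine Real.log_le_log (by positivity) ?_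
      have := pow_le_pow_left₀ (show 0 ≤ T' + 5 by linarith) (show T' + 5 ≤ T + 6 by linarith) 3
      linarith
    have k4 := abs_add_le (Ncount T' - mainTerm T') (mainTerm T' - mainTerm T)
    rw [sub_add_sub_cancel] at k4
    change |Ncount T' - mainTerm T'| ≤ _ at k1
    linarith
  obtain ⟨u, hu, hu1, hu2⟩ := hd.exists_between (show T < T + min ε 1 by
    linarith [lt_min hε one_pos])
  obtain ⟨l, hl, hl1, hl2⟩ := hd.exists_between (show max 2 (T - ε) < T from
    max_lt hT (by linarith))
  have c1 := hbound u hu (by linarith) (by linarith [min_le_right ε 1])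
    (by rw [abs_of_pos] <;> linarith [min_le_left ε 1])
  have c2 := hbound l hl ((le_max_left _ _).trans hl1.le) (by linarith)
    (by rw [abs_of_neg] <;> linarith [le_max_right 2 (T - ε)])
  have m1 := Ncount_mono hu1.le
  have m2 := Ncount_mono hl2.le
  rw [abs_le] at *
  constructor <;> linarith [c1.1, c1.2, c2.1, c2.2]

lemma exists_abs_Ncount_sub_mainTerm_le_rpow {ε : ℝ} (hε : 0 < ε) :
    ∃ C : ℝ, ∀ x : ℝ, 1 < x → |Ncount x - mainTerm x - 7 / 8| ≤ C * x ^ ε := by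
  obtain ⟨K, hK⟩ := exists_abs_Ncount_sub_mainTerm_le
  refine ⟨Ncount 2 + 3 + (300 * (Real.log 3430 + 3 / ε + 1) + |K| + 1), fun x hx => ?_⟩
  have hx1 : 1 ≤ x ^ ε := Real.one_le_rpow hx.le hε.le
  have hL : 0 ≤ Real.log 3430 := Real.log_nonneg (by norm_num)
  have hN2 := Ncount_nonneg 2
  have hKK := abs_nonneg K
  have hε3 : 0 < 3 / ε := by positivity
  have hA : |Ncount x - mainTerm x - 7 / 8| ≤ |Ncount x - mainTerm x| + 1 := by
    refine (abs_sub _ _).trans ?_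
    norm_num
  refine hA.trans ?_
  rcases le_or_gt x 2 with h2 | h2
  · have ht : 0 < x / (2 * π) := by positivity
    have ht1 : x / (2 * π) ≤ 1 := by
      rw [div_le_one (by positivity)]; linarith [Real.pi_gt_three]
    have h3 := abs_lt.1 (Real.abs_log_mul_self_lt _ ht ht1)
    have h4 := Ncount_mono h2
    have h5 := Ncount_nonneg x
    have h6 : |Ncount x - mainTerm x| ≤ Ncount 2 + 2 := by
      rw [mainTerm, abs_le]
      constructor <;> linarith [h3.1, h3.2]
    have h7 : Ncount 2 + 3 ≤
        (Ncount 2 + 3 + (300 * (Real.log 3430 + 3 / ε + 1) + |K| + 1)) * 1 := by linarith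
    have h8 := h7.trans (mul_le_mul_of_nonneg_left hx1 (by positivity))
    linarith
  · have h3 := hK x h2
    have h4 : Real.log (10 * (x + 6) ^ 3) ≤ Real.log 3430 + 3 * (x ^ ε / ε) := by
      have := pow_le_pow_left₀ (show 0 ≤ x + 6 by linarith) (show x + 6 ≤ 7 * x by linarith) 3
      have e : Real.log (3430 * x ^ 3) = Real.log 3430 + 3 * Real.log x := by
        rw [Real.log_mul (by norm_num) (by positivity), Real.log_pow]; norm_num
      have k1 : Real.log (10 * (x + 6) ^ 3) ≤ Real.log (3430 * x ^ 3) :=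
        Real.log_le_log (by positivity) (by nlinarith)
      have k2 := Real.log_le_rpow_div (show 0 ≤ x by linarith) hε
      linarith
    have h5 : 300 * (Real.log 3430 + 3 * (x ^ ε / ε) + 1) + |K| + 1 ≤
        (300 * (Real.log 3430 + 3 / ε + 1) + |K| + 1) * x ^ ε := by
      have : 3 * (x ^ ε / ε) = 3 / ε * x ^ ε := by ring
      rw [this]
      nlinarith
    have h6 : 0 ≤ (Ncount 2 + 3) * x ^ ε := by positivity
    have h7 := le_abs_self K
    linarith

lemma measurable_Ncount_sub_mainTerm : Measurable fun x => Ncount x - mainTerm x - 7 / 8 :=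
  (Ncount_mono.measurable.sub continuous_mainTerm.measurable).sub_const _

lemma integral_Ioi_one_indicator_cpow {γ : ℝ} (hγ : 1 < γ) {s : ℂ} (hs : 0 < s.re) :
    IntegrableOn (fun x : ℝ => ((if γ ≤ x then 1 else 0 : ℝ) : ℂ) * (x : ℂ) ^ (-s - 1)) (Ioi 1) ∧
    ∫ x in Ioi (1 : ℝ), ((if γ ≤ x then 1 else 0 : ℝ) : ℂ) * (x : ℂ) ^ (-s - 1) =
      (γ : ℂ) ^ (-s) / s ∧
    ∫ x in Ioi (1 : ℝ), ‖((if γ ≤ x then 1 else 0 : ℝ) : ℂ) * (x : ℂ) ^ (-s - 1)‖ =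
      ‖(γ : ℂ) ^ (-s)‖ / s.re := by
  have hγ0 : 0 < γ := by linarith
  have hs0 : s ≠ 0 := fun h => by simp [h] at hs
  have hre : (-s - 1).re < -1 := by simp; linarith
  have hset : Ioi (1 : ℝ) ∩ Ici γ = Ici γ :=
    inter_eq_right.2 fun x hx => lt_of_lt_of_le hγ hx
  have e1 : (fun x : ℝ => ((if γ ≤ x then 1 else 0 : ℝ) : ℂ) * (x : ℂ) ^ (-s - 1)) =
      (Ici γ).indicator fun x : ℝ => (x : ℂ) ^ (-s - 1) := by
    funext x
    by_cases h : γ ≤ x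
    · rw [if_pos h, indicator_of_mem (mem_Ici.2 h)]; simp
    · rw [if_neg h, indicator_of_notMem (by simpa using h)]; simp
  have e2 : (fun x : ℝ => ‖((if γ ≤ x then 1 else 0 : ℝ) : ℂ) * (x : ℂ) ^ (-s - 1)‖) =
      (Ici γ).indicator fun x : ℝ => ‖(x : ℂ) ^ (-s - 1)‖ := by
    funext x
    rw [congrFun e1 x, norm_indicator_eq_indicator_norm]
  have hInt := integrableOn_Ioi_cpow_of_lt hre hγ0
  refine ⟨?_, ?_, ?_⟩
  · rw [e1, IntegrableOn, integrable_indicator_iff measurableSet_Ici, IntegrableOn,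
      Measure.restrict_restrict measurableSet_Ici, inter_comm, hset]
    exact (integrableOn_Ici_iff_integrableOn_Ioi (by simp)).2 hInt
  · rw [e1, setIntegral_indicator measurableSet_Ici, hset, integral_Ici_eq_integral_Ioi,
      integral_Ioi_cpow_of_lt hre hγ0, show -s - 1 + 1 = -s by ring, neg_div_neg_eq]
  · rw [e2, setIntegral_indicator measurableSet_Ici, hset, integral_Ici_eq_integral_Ioi]
    rw [setIntegral_congr_fun (g := fun x : ℝ => x ^ (-s.re - 1)) measurableSet_Ioi fun x hx => by
      have : 0 < x := hγ0.trans hx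
      simp [Complex.norm_cpow_eq_rpow_re_of_pos this]]
    rw [integral_Ioi_rpow_of_lt (by linarith) hγ0, Complex.norm_cpow_eq_rpow_re_of_pos hγ0,
      show -s.re - 1 + 1 = -s.re by ring, neg_div_neg_eq, neg_re]

lemma countable_nontrivialZeros : Countable {ρ : ℂ // IsNontrivialZero ρ ∧ 0 < ρ.im} :=
  Set.Countable.to_subtype (countable_zeros_riemannXi.mono fun ρ hρ =>
    (riemannXi_eq_zero_iff ρ).2 hρ.1)

lemma IsNontrivialZero.one_lt_im {ρ : ℂ} (h : IsNontrivialZero ρ) (h0 : 0 < ρ.im) : 1 < ρ.im := by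
  simpa [abs_of_pos h0] using h.abs_im

/-- Partial summation for sums over ordinates of zeros. -/
lemma summable_and_tsum_zeros_cpow {s : ℂ} (hs : 0 < s.re)
    (hInt : IntegrableOn (fun x : ℝ => (Ncount x : ℂ) * (x : ℂ) ^ (-s - 1)) (Ioi 1)) :
    (Summable fun ρ : {ρ : ℂ // IsNontrivialZero ρ ∧ 0 < ρ.im} =>
      ‖(zetaMult ρ.1 : ℂ) * (ρ.1.im : ℂ) ^ (-s)‖) ∧
    ∑' ρ : {ρ : ℂ // IsNontrivialZero ρ ∧ 0 < ρ.im}, (zetaMult ρ.1 : ℂ) * (ρ.1.im : ℂ) ^ (-s) =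
      s * ∫ x in Ioi (1 : ℝ), (Ncount x : ℂ) * (x : ℂ) ^ (-s - 1) := by
  have := countable_nontrivialZeros
  have hs0 : s ≠ 0 := fun h => by simp [h] at hs
  set F : {ρ : ℂ // IsNontrivialZero ρ ∧ 0 < ρ.im} → ℝ → ℂ := fun ρ x =>
    (zetaMult ρ.1 : ℂ) * (((if ρ.1.im ≤ x then 1 else 0 : ℝ) : ℂ) * (x : ℂ) ^ (-s - 1)) with hF
  have hk := fun ρ : {ρ : ℂ // IsNontrivialZero ρ ∧ 0 < ρ.im} =>
    integral_Ioi_one_indicator_cpow (ρ.2.1.one_lt_im ρ.2.2) hs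
  have hFi : ∀ ρ, IntegrableOn (F ρ) (Ioi 1) := fun ρ => (hk ρ).1.const_mul _
  have hFs : ∀ x, HasSum (fun ρ => F ρ x) ((Ncount x : ℂ) * (x : ℂ) ^ (-s - 1)) := by
    intro x
    have h := ((Complex.hasSum_ofReal.2 (hasSum_Ncount x))).mul_right ((x : ℂ) ^ (-s - 1))
    refine h.congr_fun ?_
    intro ρ
    simp only [hF]
    push_cast
    ring
  have hFn : ∀ ρ, ∫ x in Ioi (1 : ℝ), ‖F ρ x‖ =
      ‖(zetaMult ρ.1 : ℂ) * (ρ.1.im : ℂ) ^ (-s)‖ / s.re := by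
    intro ρ
    simp only [hF, norm_mul (zetaMult ρ.1 : ℂ)]
    rw [integral_const_mul, (hk ρ).2.2, mul_div_assoc]
  have hFle : ∀ (u : Finset {ρ : ℂ // IsNontrivialZero ρ ∧ 0 < ρ.im}) (x : ℝ),
      ∑ ρ ∈ u, ‖F ρ x‖ ≤ ‖(Ncount x : ℂ) * (x : ℂ) ^ (-s - 1)‖ := by
    intro u x
    have h1 : ∑ ρ ∈ u, (zetaMult ρ.1 : ℝ) * (if ρ.1.im ≤ x then 1 else 0) ≤ Ncount x := by
      refine sum_le_hasSum u (fun ρ _ => ?_) (hasSum_Ncount x)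
      split_ifs <;> simp
    rw [norm_mul, Complex.norm_real, Real.norm_of_nonneg (Ncount_nonneg x)]
    refine le_trans (le_of_eq ?_) (mul_le_mul_of_nonneg_right h1 (norm_nonneg _))
    rw [Finset.sum_mul]
    refine Finset.sum_congr rfl fun ρ _ => ?_
    simp only [hF]
    split_ifs <;> simp
  have hsum : Summable fun ρ => ∫ x in Ioi (1 : ℝ), ‖F ρ x‖ := by
    refine summable_of_sum_le (fun ρ => integral_nonneg fun _ => norm_nonneg _)
      (c := ∫ x in Ioi (1 : ℝ), ‖(Ncount x : ℂ) * (x : ℂ) ^ (-s - 1)‖) fun u => ?_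
    rw [← integral_finsetSum _ fun ρ _ => (hFi ρ).norm]
    exact integral_mono (integrable_finsetSum _ fun ρ _ => (hFi ρ).norm) hInt.norm (hFle u)
  have hS := hasSum_integral_of_summable_integral_norm hFi hsum
  refine ⟨?_, ?_⟩
  · refine (hsum.mul_right s.re).congr fun ρ => ?_
    rw [hFn, div_mul_cancel₀ _ hs.ne']
  · simp only [fun x => (hFs x).tsum_eq] at hS
    rw [← (hS.mul_left s).tsum_eq]
    refine tsum_congr fun ρ => ?_
    simp only [hF]
    rw [integral_const_mul, (hk ρ).2.1]
    field_simp

lemma integral_Ioi_one_log_mul_cpow {s : ℂ} (hs : 1 < s.re) :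
    IntegrableOn (fun x : ℝ => (Real.log x : ℂ) * (x : ℂ) ^ (-s)) (Ioi 1) ∧
    ∫ x in Ioi (1 : ℝ), (Real.log x : ℂ) * (x : ℂ) ^ (-s) = 1 / (s - 1) ^ 2 := by
  set δ := (s.re - 1) / 2 with hδ
  have hδ0 : 0 < δ := by rw [hδ]; linarith
  have hs1 : s - 1 ≠ 0 := fun h => by
    have := congrArg Complex.re h
    simp at this
    linarith
  have hlog : ∀ x : ℝ, 1 < x → |Real.log x| ≤ 1 / δ * x ^ δ := by
    intro x hx
    rw [abs_of_nonneg (Real.log_nonneg hx.le)]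
    have := Real.log_le_rpow_div (show 0 ≤ x by linarith) hδ0
    rwa [div_eq_inv_mul, ← one_div] at this
  have hInt : IntegrableOn (fun x : ℝ => (Real.log x : ℂ) * (x : ℂ) ^ (-s)) (Ioi 1) := by
    have := (integrableOn_and_differentiableAt_integral_cpow Real.measurable_log hlog
      (s := s - 1) (by simp; linarith)).1
    simpa only [show -(s - 1) - 1 = -s by ring] using this
  refine ⟨hInt, ?_⟩
  have hder : ∀ x ∈ Ici (1 : ℝ), HasDerivAt (fun x : ℝ => -(Real.log x : ℂ) * (x : ℂ) ^ (1 - s) /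
      (s - 1) - (x : ℂ) ^ (1 - s) / (s - 1) ^ 2) ((Real.log x : ℂ) * (x : ℂ) ^ (-s)) x := by
    intro x hx
    have hx0 : 0 < x := lt_of_lt_of_le one_pos hx
    have hxc : (x : ℂ) ≠ 0 := by exact_mod_cast hx0.ne'
    have d1 := hasDerivAt_ofReal_cpow_of_pos hx0 (1 - s)
    have d2 := (Real.hasDerivAt_log hx0.ne').ofReal_comp
    refine (((d2.fun_neg.fun_mul d1).div_const (s - 1)).fun_sub
      (d1.div_const ((s - 1) ^ 2))).congr_deriv ?_
    have e : (x : ℂ) ^ (1 - s) = x * (x : ℂ) ^ (-s) := by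
      rw [sub_eq_add_neg, Complex.cpow_add _ _ hxc, Complex.cpow_one]
    rw [show (1 - s - 1) = -s by ring, e]
    push_cast
    field_simp
    ring
  have hlim : Tendsto (fun x : ℝ => -(Real.log x : ℂ) * (x : ℂ) ^ (1 - s) /
      (s - 1) - (x : ℂ) ^ (1 - s) / (s - 1) ^ 2) atTop (nhds 0) := by
    have t1 : Tendsto (fun x : ℝ => (x : ℂ) ^ (1 - s)) atTop (nhds 0) := by
      refine squeeze_zero_norm' ?_ (tendsto_rpow_neg_atTop (show 0 < s.re - 1 by linarith))
      filter_upwards [eventually_gt_atTop 0] with x hx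
      rw [Complex.norm_cpow_eq_rpow_re_of_pos hx]
      simp
    have t2 : Tendsto (fun x : ℝ => -(Real.log x : ℂ) * (x : ℂ) ^ (1 - s)) atTop (nhds 0) := by
      have t3 := (tendsto_rpow_neg_atTop hδ0).const_mul (1 / δ)
      rw [mul_zero] at t3
      refine squeeze_zero_norm' ?_ t3
      filter_upwards [eventually_gt_atTop 1] with x hx
      have hx0 : 0 < x := by linarith
      rw [norm_mul, norm_neg, Complex.norm_real, Complex.norm_cpow_eq_rpow_re_of_pos hx0,
        Real.norm_eq_abs]
      refine (mul_le_mul_of_nonneg_right (hlog x hx) (by positivity)).trans (le_of_eq ?_)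
      rw [mul_assoc, ← Real.rpow_add hx0]
      congr 2
      rw [hδ]; simp; ring
    simpa using (t2.div_const (s - 1)).sub (t1.div_const ((s - 1) ^ 2))
  rw [integral_Ioi_of_hasDerivAt_of_tendsto' hder hInt hlim]
  simp

lemma integral_Ncount_mul_cpow {s : ℂ} (hs : 1 < s.re)
    (hE : IntegrableOn (fun x : ℝ => ((Ncount x - mainTerm x - 7 / 8 : ℝ) : ℂ) *
      (x : ℂ) ^ (-s - 1)) (Ioi 1)) :
    IntegrableOn (fun x : ℝ => (Ncount x : ℂ) * (x : ℂ) ^ (-s - 1)) (Ioi 1) ∧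
    s * ∫ x in Ioi (1 : ℝ), (Ncount x : ℂ) * (x : ℂ) ^ (-s - 1) =
      1 / (2 * (π : ℂ) * (s - 1) ^ 2) - (Real.log (2 * π) : ℂ) / (2 * (π : ℂ) * (s - 1)) +
        (7 / 8 - (Real.log (2 * π) + 1) / (2 * π)) +
        s * ∫ x in Ioi (1 : ℝ), ((Ncount x - mainTerm x - 7 / 8 : ℝ) : ℂ) *
          (x : ℂ) ^ (-s - 1) := by
  have hs0 : s ≠ 0 := fun h => by simp [h] at hs; linarith
  have hs1 : s - 1 ≠ 0 := fun h => by
    have := congrArg Complex.re h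
    simp at this
    linarith
  have hpi : (π : ℂ) ≠ 0 := by exact_mod_cast Real.pi_ne_zero
  obtain ⟨hL, hLv⟩ := integral_Ioi_one_log_mul_cpow hs
  have hP := integrableOn_Ioi_cpow_of_lt (a := -s) (by simpa using hs) one_pos
  have hPv := integral_Ioi_cpow_of_lt (a := -s) (by simpa using hs) one_pos
  have hQ := integrableOn_Ioi_cpow_of_lt (a := -s - 1) (by simp; linarith) one_pos
  have hQv := integral_Ioi_cpow_of_lt (a := -s - 1) (by simp; linarith) one_pos
  have heq : EqOn (fun x : ℝ => (Ncount x : ℂ) * (x : ℂ) ^ (-s - 1))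
      (fun x : ℝ => ((Ncount x - mainTerm x - 7 / 8 : ℝ) : ℂ) * (x : ℂ) ^ (-s - 1) +
        1 / (2 * π) * ((Real.log x : ℂ) * (x : ℂ) ^ (-s)) -
        (Real.log (2 * π) + 1) / (2 * π) * (x : ℂ) ^ (-s) +
        7 / 8 * (x : ℂ) ^ (-s - 1)) (Ioi 1) := by
    intro x hx
    have hx0 : 0 < x := one_pos.trans hx
    have hxc : (x : ℂ) ≠ 0 := by exact_mod_cast hx0.ne'
    have e : (x : ℂ) ^ (-s) = x * (x : ℂ) ^ (-s - 1) := by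
      conv_lhs => rw [show -s = 1 + (-s - 1) by ring]
      rw [Complex.cpow_add _ _ hxc, Complex.cpow_one]
    simp only [mainTerm]
    rw [Real.log_div hx0.ne' (by positivity), e]
    push_cast
    field_simp
    ring
  have i1 : IntegrableOn (fun x : ℝ => ((Ncount x - mainTerm x - 7 / 8 : ℝ) : ℂ) *
      (x : ℂ) ^ (-s - 1) + 1 / (2 * π) * ((Real.log x : ℂ) * (x : ℂ) ^ (-s))) (Ioi 1) :=
    hE.add (hL.const_mul (1 / (2 * π)))
  have i2 := hP.const_mul ((Real.log (2 * π) + 1) / (2 * π) : ℂ)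
  have i3 := hQ.const_mul (7 / 8)
  have i4 : IntegrableOn (fun x : ℝ => ((Ncount x - mainTerm x - 7 / 8 : ℝ) : ℂ) *
      (x : ℂ) ^ (-s - 1) + 1 / (2 * π) * ((Real.log x : ℂ) * (x : ℂ) ^ (-s)) -
      (Real.log (2 * π) + 1) / (2 * π) * (x : ℂ) ^ (-s)) (Ioi 1) := i1.sub i2
  refine ⟨(i4.add i3).congr_fun heq.symm measurableSet_Ioi, ?_⟩
  rw [setIntegral_congr_fun measurableSet_Ioi heq]
  rw [integral_add i4 i3, integral_sub i1 i2,
    integral_add hE (hL.const_mul (1 / (2 * π))), integral_const_mul, integral_const_mul,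
    integral_const_mul, hLv, hPv, hQv]
  simp only [ofReal_one, one_cpow]
  rw [show -s + 1 = -(s - 1) by ring, show -s - 1 + 1 = -s by ring, neg_div_neg_eq,
    neg_div_neg_eq]
  generalize (∫ x in Ioi (1 : ℝ), ((Ncount x - mainTerm x - 7 / 8 : ℝ) : ℂ) *
          (x : ℂ) ^ (-s - 1)) = J
  obtain ⟨w, rfl⟩ : ∃ w, s = w + 1 := ⟨s - 1, by ring⟩
  rw [add_sub_cancel_right] at *
  field_simp
  ring

theorem statement0 (S : ℝ → ℝ) (hS : IsS S) (f : ℝ → ℝ)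
    (hf : ∀ T : ℝ, f T =
      Ncount T - T / (2 * π) * Real.log (T / (2 * π)) + T / (2 * π) - 7/8 - S T) :
    (∀ s : ℂ, 1 < s.re →
      Summable (fun ρ : {ρ : ℂ // IsNontrivialZero ρ ∧ 0 < ρ.im} =>
        ‖(zetaMult ρ.1 : ℂ) * (ρ.1.im : ℂ) ^ (-s)‖)) ∧
    ∃ G : ℂ → ℂ, ∃ C₁ : ℂ,
      (∀ s : ℂ, 1 < s.re →
        G s = ∑' ρ : {ρ : ℂ // IsNontrivialZero ρ ∧ 0 < ρ.im},
          (zetaMult ρ.1 : ℂ) * (ρ.1.im : ℂ) ^ (-s)) ∧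
      (∀ s : ℂ, 0 < s.re → s ≠ 1 →
        DifferentiableAt ℂ G s ∧
        IntegrableOn (fun x : ℝ => ((S x + f x : ℝ) : ℂ) * (x : ℂ) ^ (-s - 1)) (Ioi 1) ∧
        G s = 1 / (2 * (π : ℂ) * (s - 1) ^ 2)
          - (Real.log (2 * π) : ℂ) / (2 * (π : ℂ) * (s - 1)) + C₁
          + s * ∫ x in Ioi (1 : ℝ), ((S x + f x : ℝ) : ℂ) * (x : ℂ) ^ (-s - 1)) := by
  have hEq : ∀ x, S x + f x = Ncount x - mainTerm x - 7 / 8 := fun x => by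
    rw [hf, mainTerm]; ring
  have hE : ∀ s : ℂ, 0 < s.re →
      IntegrableOn (fun x : ℝ => ((Ncount x - mainTerm x - 7 / 8 : ℝ) : ℂ) *
        (x : ℂ) ^ (-s - 1)) (Ioi 1) ∧
      DifferentiableAt ℂ (fun s => ∫ x in Ioi (1 : ℝ),
        ((Ncount x - mainTerm x - 7 / 8 : ℝ) : ℂ) * (x : ℂ) ^ (-s - 1)) s := by
    intro s hs
    obtain ⟨C, hC⟩ := exists_abs_Ncount_sub_mainTerm_le_rpow (half_pos hs)
    exact integrableOn_and_differentiableAt_integral_cpow measurable_Ncount_sub_mainTerm hC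
      (half_lt_self hs)
  have hN : ∀ s : ℂ, 1 < s.re → _ := fun s hs =>
    integral_Ncount_mul_cpow hs (hE s (one_pos.trans hs)).1
  simp only [hEq]
  refine ⟨fun s hs => (summable_and_tsum_zeros_cpow (one_pos.trans hs) (hN s hs).1).1,
    fun s => 1 / (2 * (π : ℂ) * (s - 1) ^ 2) - (Real.log (2 * π) : ℂ) / (2 * (π : ℂ) * (s - 1)) +
      (7 / 8 - (Real.log (2 * π) + 1) / (2 * π)) +
      s * ∫ x in Ioi (1 : ℝ), ((Ncount x - mainTerm x - 7 / 8 : ℝ) : ℂ) * (x : ℂ) ^ (-s - 1),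
    7 / 8 - (Real.log (2 * π) + 1) / (2 * π), fun s hs => ?_,
    fun s hs hs1 => ⟨?_, (hE s hs).1, rfl⟩⟩
  · rw [(summable_and_tsum_zeros_cpow (one_pos.trans hs) (hN s hs).1).2, (hN s hs).2]
  · have hpi : (π : ℂ) ≠ 0 := by exact_mod_cast Real.pi_ne_zero
    have hs1' : s - 1 ≠ 0 := sub_ne_zero.2 hs1
    refine DifferentiableAt.add (DifferentiableAt.add_const _ (DifferentiableAt.sub ?_ ?_))
      (differentiableAt_id.mul (hE s hs).2)
    · exact (differentiableAt_const _).div (by fun_prop)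
        (mul_ne_zero (mul_ne_zero two_ne_zero hpi) (pow_ne_zero _ hs1'))
    · exact (differentiableAt_const _).div (by fun_prop)
        (mul_ne_zero (mul_ne_zero two_ne_zero hpi) hs1')
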